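/- Let d ≥ 1, K > 0, and let u ∈ X_4^d(K) satisfy Δu = f on (0,1)^d and u = 0 on ∂[0,1]^d. For a level vector l ∈ ℕ^d with h_k = 2^{−l_k}, let u_h be the central finite difference solution on the associated grid and I u_h its multilinear interpolant. Then there is a family of functions v_J, indexed by the nonempty subsets J ⊆ {1,…,d} and by dyadic mesh sizes (h_j)_{j∈J}, with v_J(·;(h_j)_{j∈J}) : [0,1]^d → ℝ and ‖v_J(·;(h_j)_{j∈J})‖_∞ ≤ 150188·K·m!/96^m (m = |J|), such that for every level vector l and every x ∈ [0,1]^d, u(x) − (I u_h)(x) = Σ_{∅≠J⊆{1,…,d}} v_J(x;(h_j)_{j∈J})·Π_{j∈J} h_j². In particular v_J depends only on the mesh sizes h_j with j ∈ J. -/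

import Mathlib

/-- Partial derivative of `u` in direction `i` (one-sided within `[0,1]` at the
boundary): `∂ᵢu(x) = d/dt u(x₁,…,t,…,x_d)|_{t = xᵢ}` taken within `[0,1]`. -/
noncomputable def pd (d : ℕ) (i : Fin d) (u : (Fin d → ℝ) → ℝ) : (Fin d → ℝ) → ℝ :=
  fun x => derivWithin (fun t => u (Function.update x i t)) (Set.Icc 0 1) (x i)

/-- Mixed partial derivative `D^α u = ∂₁^{α₁} ⋯ ∂_d^{α_d} u`. -/
noncomputable def mderiv (d : ℕ) (α : Fin d → ℕ) (u : (Fin d → ℝ) → ℝ) :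
    (Fin d → ℝ) → ℝ :=
  (List.finRange d).foldr (fun i v => (pd d i)^[α i] v) u

/-- The closed unit cube `[0,1]^d`. -/
def unitCube (d : ℕ) : Set (Fin d → ℝ) := Set.Icc 0 1

/-- The open unit cube `(0,1)^d`. -/
def openCube (d : ℕ) : Set (Fin d → ℝ) := Set.pi Set.univ fun _ => Set.Ioo (0 : ℝ) 1

/-- The boundary `∂[0,1]^d`. -/
def cubeBdry (d : ℕ) : Set (Fin d → ℝ) := {x ∈ unitCube d | ∃ i, x i = 0 ∨ x i = 1}

/-- All mixed partial derivatives `D^β f`, `β ≤ α`, exist on `s` (each step of the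
iterated differentiation is differentiable within `[0,1]` in its direction). -/
def HasDerivsOn (d : ℕ) (α : Fin d → ℕ) (f : (Fin d → ℝ) → ℝ)
    (s : Set (Fin d → ℝ)) : Prop :=
  ∀ β : Fin d → ℕ, (∀ i, β i ≤ α i) → ∀ i : Fin d, β i < α i → ∀ x ∈ s,
    DifferentiableWithinAt ℝ (fun t => mderiv d β f (Function.update x i t))
      (Set.Icc 0 1) (x i)

/-- `u ∈ X_k^d`: all mixed derivatives `D^α u`, `α ∈ {0,…,k}^d`, exist, are
continuous on `[0,1]^d` and vanish on the boundary. -/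
def MemX (d k : ℕ) (u : (Fin d → ℝ) → ℝ) : Prop :=
  HasDerivsOn d (fun _ => k) u (unitCube d) ∧
  ∀ α : Fin d → ℕ, (∀ i, α i ≤ k) →
    ContinuousOn (mderiv d α u) (unitCube d) ∧
    ∀ x ∈ cubeBdry d, mderiv d α u x = 0

/-- `u ∈ X_k^d(K)`: additionally all these derivatives are bounded by `K`. -/
def MemXb (d k : ℕ) (K : ℝ) (u : (Fin d → ℝ) → ℝ) : Prop :=
  MemX d k u ∧
  ∀ α : Fin d → ℕ, (∀ i, α i ≤ k) → ∀ x ∈ unitCube d, |mderiv d α u x| ≤ K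

/-- Mesh size `h_k = 2^{-lvl_k}` attached to a level vector. -/
noncomputable def hmesh (d : ℕ) (lvl : Fin d → ℕ) (k : Fin d) : ℝ := ((2 : ℝ) ^ lvl k)⁻¹

/-- The grid point with index `i` on the grid of level `lvl`. -/
noncomputable def gridpt (d : ℕ) (lvl : Fin d → ℕ) (i : Fin d → ℕ) : Fin d → ℝ :=
  fun k => (i k : ℝ) * hmesh d lvl k

/-- Valid grid indices: `0 ≤ i_k ≤ 2^{lvl_k}`. -/
def IsGridIdx (d : ℕ) (lvl : Fin d → ℕ) (i : Fin d → ℕ) : Prop := ∀ k, i k ≤ 2 ^ lvl k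

/-- The hyperplane set `I^{(J)} = {x ∈ [0,1]^d : x_j/h_j ∈ ℤ for j ∈ J}`. -/
def Iplane (d : ℕ) (J : Finset (Fin d)) (lvl : Fin d → ℕ) : Set (Fin d → ℝ) :=
  {x ∈ unitCube d | ∀ j ∈ J, ∃ m : ℤ, x j = (m : ℝ) * hmesh d lvl j}

/-- `U` is the central finite difference solution of the Poisson problem `Δu = f`
with zero Dirichlet data on the grid of level `lvl`. -/
def IsFDPoisson (d : ℕ) (lvl : Fin d → ℕ) (f : (Fin d → ℝ) → ℝ)
    (U : (Fin d → ℕ) → ℝ) : Prop :=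
  (∀ i : Fin d → ℕ, IsGridIdx d lvl i → (∃ k, i k = 0 ∨ i k = 2 ^ lvl k) → U i = 0) ∧
  (∀ i : Fin d → ℕ, (∀ k, 1 ≤ i k ∧ i k < 2 ^ lvl k) →
    ∑ k, (U (Function.update i k (i k + 1)) - 2 * U i + U (Function.update i k (i k - 1)))
        / hmesh d lvl k ^ 2
      = f (gridpt d lvl i))

/-- `U` is the upwind (implicit Euler) solution of the advection equation
`Σᵢ ∂ᵢu = 0` on the grid of level `lvl`, with inflow data given by `u`. -/
def IsUpwindSol (d : ℕ) (lvl : Fin d → ℕ) (u : (Fin d → ℝ) → ℝ)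
    (U : (Fin d → ℕ) → ℝ) : Prop :=
  (∀ i : Fin d → ℕ, IsGridIdx d lvl i → (∃ k, i k = 0) → U i = u (gridpt d lvl i)) ∧
  (∀ i : Fin d → ℕ, IsGridIdx d lvl i → (∀ k, 1 ≤ i k) →
    ∑ k, (U i - U (Function.update i k (i k - 1))) / hmesh d lvl k = 0)

/-- `g` is the multilinear interpolant of the grid function `U` on the grid of
level `lvl`: it agrees with `U` at all grid points and is a polynomial of degree
at most `1` in each variable on each grid cell. -/
def IsInterp (d : ℕ) (lvl : Fin d → ℕ) (U : (Fin d → ℕ) → ℝ)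
    (g : (Fin d → ℝ) → ℝ) : Prop :=
  (∀ i : Fin d → ℕ, IsGridIdx d lvl i → g (gridpt d lvl i) = U i) ∧
  (∀ j : Fin d → ℕ, (∀ k, j k < 2 ^ lvl k) →
    ∃ c : Finset (Fin d) → ℝ, ∀ x : Fin d → ℝ,
      (∀ k, (j k : ℝ) * hmesh d lvl k ≤ x k ∧ x k ≤ ((j k : ℝ) + 1) * hmesh d lvl k) →
      g x = ∑ T : Finset (Fin d), c T * ∏ k ∈ T, x k)

/-- The domain `{x : x ± h e_k ∈ [0,1]^d}` of the truncation error terms. -/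
def diffDom (d : ℕ) (k : Fin d) (h : ℝ) : Set (Fin d → ℝ) :=
  {x | Function.update x k (x k + h) ∈ unitCube d ∧
       Function.update x k (x k - h) ∈ unitCube d}

namespace PoissonFD

/-- Three-point stencil on `ℤ` with position-dependent coefficients and nodes. -/
structure Stencil where
  coeff : Fin 3 → ℤ → ℝ
  node : Fin 3 → ℤ → ℤ

namespace Stencil

/-- Action of a stencil on functions of one integer variable. -/
def apply (σ : Stencil) (z : ℤ → ℝ) (t : ℤ) : ℝ := ∑ m, σ.coeff m t * z (σ.node m t)

/-- Action of a stencil on grid functions in the coordinate direction `k`. -/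
def op {d : ℕ} (σ : Stencil) (k : Fin d) : Module.End ℝ ((Fin d → ℤ) → ℝ) where
  toFun w i := ∑ m, σ.coeff m (i k) * w (Function.update i k (σ.node m (i k)))
  map_add' v w := by
    ext i
    simp [mul_add, Finset.sum_add_distrib]
  map_smul' c w := by
    ext i
    simp only [Pi.smul_apply, smul_eq_mul, RingHom.id_apply, Finset.mul_sum]
    exact Finset.sum_congr rfl fun m _ => by ring

theorem op_apply {d : ℕ} (σ : Stencil) (k : Fin d) (w : (Fin d → ℤ) → ℝ) (i : Fin d → ℤ) :
    σ.op k w i = ∑ m, σ.coeff m (i k) * w (Function.update i k (σ.node m (i k))) := rfl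

theorem op_line {d : ℕ} (σ : Stencil) (k : Fin d) (w : (Fin d → ℤ) → ℝ) (i : Fin d → ℤ) :
    (fun t => σ.op k w (Function.update i k t)) =
      σ.apply (fun t => w (Function.update i k t)) := by
  ext t
  simp [op_apply, apply]

theorem op_eq_apply {d : ℕ} (σ : Stencil) (k : Fin d) (w : (Fin d → ℤ) → ℝ) (i : Fin d → ℤ) :
    σ.op k w i = σ.apply (fun t => w (Function.update i k t)) (i k) := by
  simp [op_apply, apply]

theorem op_line_of_ne {d : ℕ} (σ : Stencil) {j k : Fin d} (h : j ≠ k)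
    (w : (Fin d → ℤ) → ℝ) (i : Fin d → ℤ) (t : ℤ) :
    σ.op k w (Function.update i j t) =
      ∑ m, σ.coeff m (i k) * w (Function.update (Function.update i k (σ.node m (i k))) j t) := by
  simp [op_apply, Function.update_of_ne h.symm, Function.update_comm h]

theorem op_commute {d : ℕ} (σ τ : Stencil) {j k : Fin d} (h : j ≠ k) :
    Commute (σ.op j) (τ.op k) := by
  refine LinearMap.ext fun w => funext fun i => ?_
  simp only [Module.End.mul_apply, op_apply, Finset.mul_sum, Function.update_of_ne h,
    Function.update_of_ne h.symm]
  rw [Finset.sum_comm]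
  refine Finset.sum_congr rfl fun m _ => Finset.sum_congr rfl fun n _ => ?_
  rw [Function.update_comm h]
  ring

theorem op_commute_of_apply {d : ℕ} (σ τ : Stencil) (k : Fin d)
    (h : ∀ z, σ.apply (τ.apply z) = τ.apply (σ.apply z)) :
    Commute (σ.op k) (τ.op k) := by
  refine LinearMap.ext fun w => funext fun i => ?_
  simp only [Module.End.mul_apply]
  rw [op_eq_apply, op_eq_apply, op_line, op_line, h]

end Stencil

/-- Central second difference quotient with step `ρ / M`. -/
noncomputable def diff2 (M ρ : ℕ) : Stencil where
  coeff := ![fun _ => ((M : ℝ) / ρ) ^ 2, fun _ => -2 * ((M : ℝ) / ρ) ^ 2,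
    fun _ => ((M : ℝ) / ρ) ^ 2]
  node := ![fun t => t + ρ, fun t => t, fun t => t - ρ]

/-- Piecewise linear interpolation of the values at multiples of `ρ`. -/
noncomputable def interp (ρ : ℕ) : Stencil where
  coeff := ![fun t => 1 - ((t % ρ : ℤ) : ℝ) / ρ, fun t => ((t % ρ : ℤ) : ℝ) / ρ, fun _ => 0]
  node := ![fun t => t - t % ρ, fun t => t - t % ρ + ρ, fun t => t]

theorem diff2_apply (M ρ : ℕ) (z : ℤ → ℝ) (t : ℤ) :
    (diff2 M ρ).apply z t = ((M : ℝ) / ρ) ^ 2 * (z (t + ρ) - 2 * z t + z (t - ρ)) := by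
  simp [Stencil.apply, diff2, Fin.sum_univ_three]
  ring

theorem interp_apply (ρ : ℕ) (z : ℤ → ℝ) (t : ℤ) :
    (interp ρ).apply z t = (1 - ((t % ρ : ℤ) : ℝ) / ρ) * z (t - t % ρ) +
      ((t % ρ : ℤ) : ℝ) / ρ * z (t - t % ρ + ρ) := by
  simp [Stencil.apply, interp, Fin.sum_univ_three]

theorem interp_apply_of_dvd {ρ : ℕ} (z : ℤ → ℝ) {t : ℤ} (h : (ρ : ℤ) ∣ t) :
    (interp ρ).apply z t = z t := by
  simp [interp_apply, Int.emod_eq_zero_of_dvd h]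

theorem interp_weight_mem {ρ : ℕ} (hρ : 0 < ρ) (t : ℤ) :
    0 ≤ ((t % ρ : ℤ) : ℝ) / ρ ∧ ((t % ρ : ℤ) : ℝ) / ρ ≤ 1 := by
  have h0 : 0 ≤ t % ρ := Int.emod_nonneg _ (by positivity)
  have h1 : t % ρ < ρ := Int.emod_lt_of_pos _ (by positivity)
  have h0' : (0 : ℝ) ≤ ((t % ρ : ℤ) : ℝ) := by exact_mod_cast h0
  have h1' : ((t % ρ : ℤ) : ℝ) ≤ ρ := by exact_mod_cast h1.le
  refine ⟨by positivity, ?_⟩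
  rw [div_le_one (by positivity)]
  exact h1'

theorem interp_dvd_node (ρ : ℕ) (t : ℤ) : (ρ : ℤ) ∣ t - t % ρ :=
  Int.dvd_self_sub_emod

theorem interp_idem (ρ : ℕ) (z : ℤ → ℝ) :
    (interp ρ).apply ((interp ρ).apply z) = (interp ρ).apply z := by
  ext t
  rw [interp_apply, interp_apply_of_dvd z (interp_dvd_node ρ t),
    interp_apply_of_dvd z ((interp_dvd_node ρ t).add (dvd_refl _)), interp_apply]

theorem interp_one (z : ℤ → ℝ) : (interp 1).apply z = z := by
  ext t
  exact interp_apply_of_dvd z (by simp)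

theorem interp_diff2_comm (M ρ : ℕ) (z : ℤ → ℝ) :
    (interp ρ).apply ((diff2 M ρ).apply z) = (diff2 M ρ).apply ((interp ρ).apply z) := by
  ext t
  have h1 : (t + ρ) % (ρ : ℤ) = t % ρ := by simp
  have h2 : (t - ρ) % (ρ : ℤ) = t % ρ := by simp
  simp only [interp_apply, diff2_apply, h1, h2]
  have e1 : t + ρ - t % ρ = t - t % ρ + ρ := by ring
  have e2 : t - ρ - t % ρ = t - t % ρ - ρ := by ring
  have e3 : t - t % (ρ : ℤ) + ρ - ρ = t - t % ρ := by ring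
  have e4 : t - t % (ρ : ℤ) - ρ + ρ = t - t % ρ := by ring
  simp only [e1, e2, e3, e4]
  ring

theorem abs_convexComb_le {a x y B : ℝ} (h0 : 0 ≤ a) (h1 : a ≤ 1) (hx : |x| ≤ B) (hy : |y| ≤ B) :
    |(1 - a) * x + a * y| ≤ B := by
  rw [abs_le] at *
  constructor <;> nlinarith

theorem abs_interp_le {ρ : ℕ} (hρ : 0 < ρ) {z : ℤ → ℝ} {B : ℝ} (h : ∀ t, |z t| ≤ B) (t : ℤ) :
    |(interp ρ).apply z t| ≤ B := by
  rw [interp_apply]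
  obtain ⟨h0, h1⟩ := interp_weight_mem hρ t
  exact abs_convexComb_le h0 h1 (h _) (h _)

/-! ### Comparison of stencils in one variable -/

theorem nonneg_of_second_diff_nonneg {e : ℕ → ℝ} (h0 : 0 ≤ e 0) (h1 : e 0 ≤ e 1)
    (h : ∀ r, 0 ≤ e (r + 2) - 2 * e (r + 1) + e r) (r : ℕ) : 0 ≤ e r := by
  suffices H : ∀ r, 0 ≤ e r ∧ e r ≤ e (r + 1) from (H r).1
  intro r
  induction r with
  | zero => exact ⟨h0, h1⟩
  | succ r ih =>
    have := h r
    constructor <;> linarith [ih.1, ih.2]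

theorem abs_second_diff_le {z : ℤ → ℝ} {Y : ℝ}
    (h : ∀ t, |z (t + 1) - 2 * z t + z (t - 1)| ≤ Y) (c : ℤ) (r : ℕ) :
    |z (c + r) - 2 * z c + z (c - r)| ≤ r ^ 2 * Y := by
  have key : ∀ s : ℝ, |s| = 1 →
      0 ≤ (r : ℝ) ^ 2 * Y - s * (z (c + r) - 2 * z c + z (c - r)) := by
    intro s hs
    refine nonneg_of_second_diff_nonneg
      (e := fun r : ℕ => (r : ℝ) ^ 2 * Y - s * (z (c + r) - 2 * z c + z (c - r))) ?_ ?_ ?_ r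
    · simp
      linarith
    · have := (le_abs_self _).trans ((abs_mul s _).trans_le
        (mul_le_mul hs.le (h c) (abs_nonneg _) zero_le_one))
      simp
      linarith
    · intro r
      have a1 := (le_abs_self _).trans ((abs_mul s _).trans_le
        (mul_le_mul hs.le (h (c + r + 1)) (abs_nonneg _) zero_le_one))
      have a2 := (le_abs_self _).trans ((abs_mul s _).trans_le
        (mul_le_mul hs.le (h (c - r - 1)) (abs_nonneg _) zero_le_one))
      push_cast
      have e1 : c + (r + 2 : ℤ) = c + r + 1 + 1 := by ring
      have e2 : c + (r + 1 : ℤ) = c + r + 1 := by ring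
      have e3 : c - (r + 2 : ℤ) = c - r - 1 - 1 := by ring
      have e4 : c - (r + 1 : ℤ) = c - r - 1 := by ring
      have e5 : c + r + 1 - 1 = c + (r : ℤ) := by ring
      have e6 : c - r - 1 + 1 = c - (r : ℤ) := by ring
      rw [e1, e2, e3, e4]
      rw [e5] at a1
      rw [e6] at a2
      linarith
  have h1 := key 1 (by simp)
  have h2 := key (-1) (by simp)
  rw [abs_le]
  constructor <;> linarith

theorem abs_second_diff_sub_le {z q : ℤ → ℝ} {Y : ℝ}
    (hq : ∀ t, q t = z (t + 1) - 2 * z t + z (t - 1))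
    (h : ∀ t, |q (t + 1) - 2 * q t + q (t - 1)| ≤ Y) (c : ℤ) (r : ℕ) :
    |z (c + r) - 2 * z c + z (c - r) - r ^ 2 * q c| ≤ ((r : ℝ) ^ 4 - r ^ 2) / 12 * Y := by
  have key : ∀ s : ℝ, |s| = 1 →
      0 ≤ ((r : ℝ) ^ 4 - r ^ 2) / 12 * Y -
        s * (z (c + r) - 2 * z c + z (c - r) - r ^ 2 * q c) := by
    intro s hs
    refine nonneg_of_second_diff_nonneg (e := fun r : ℕ => ((r : ℝ) ^ 4 - r ^ 2) / 12 * Y -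
        s * (z (c + r) - 2 * z c + z (c - r) - r ^ 2 * q c)) ?_ ?_ ?_ r
    · simp
      linarith
    · simp [hq]
      linarith
    · intro r
      have a1 := (le_abs_self _).trans ((abs_mul s _).trans_le
        (mul_le_mul hs.le (abs_second_diff_le h c (r + 1)) (abs_nonneg _) zero_le_one))
      have a2 := hq (c + r + 1)
      have a3 := hq (c - r - 1)
      push_cast at a1 ⊢
      have e1 : c + (r + 2 : ℤ) = c + r + 1 + 1 := by ring
      have e2 : c + (r + 1 : ℤ) = c + r + 1 := by ring
      have e3 : c - (r + 2 : ℤ) = c - r - 1 - 1 := by ring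
      have e4 : c - (r + 1 : ℤ) = c - r - 1 := by ring
      have e5 : c + r + 1 - 1 = c + (r : ℤ) := by ring
      have e6 : c - r - 1 + 1 = c - (r : ℤ) := by ring
      rw [e1, e2, e3, e4]
      rw [e2, e4, a2, a3, e5, e6] at a1
      linarith
  have h1 := key 1 (by simp)
  have h2 := key (-1) (by simp)
  rw [abs_le]
  constructor <;> linarith

theorem abs_diff2_sub_diff2_le {M ρ : ℕ} (hM : 0 < M) (hρ : 0 < ρ) {z : ℤ → ℝ} {Y : ℝ}
    (h : ∀ t, |(diff2 M 1).apply ((diff2 M 1).apply z) t| ≤ Y) (t : ℤ) :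
    |(diff2 M ρ).apply z t - (diff2 M 1).apply z t| ≤ ((ρ : ℝ) / M) ^ 2 / 12 * Y := by
  have hM' : (0 : ℝ) < M := by exact_mod_cast hM
  have hρ' : (0 : ℝ) < ρ := by exact_mod_cast hρ
  have hY : 0 ≤ Y := (abs_nonneg _).trans (h 0)
  have key := abs_second_diff_sub_le (z := z) (Y := Y / M ^ 4) (fun _ => rfl) (fun s => by
    have := h s
    simp only [diff2_apply, Nat.cast_one, div_one] at this
    rw [show ∀ a b c : ℝ, (M : ℝ) ^ 2 * ((M : ℝ) ^ 2 * a - 2 * ((M : ℝ) ^ 2 * b) +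
      (M : ℝ) ^ 2 * c) = (M : ℝ) ^ 4 * (a - 2 * b + c) by intros; ring, abs_mul,
      abs_of_pos (by positivity)] at this
    rw [le_div_iff₀ (by positivity), mul_comm]
    exact this) t ρ
  have e : (diff2 M ρ).apply z t - (diff2 M 1).apply z t = ((M : ℝ) / ρ) ^ 2 *
      (z (t + ρ) - 2 * z t + z (t - ρ) - (ρ : ℝ) ^ 2 * (z (t + 1) - 2 * z t + z (t - 1))) := by
    simp only [diff2_apply, Nat.cast_one, div_one]
    field_simp
  rw [e, abs_mul, abs_of_nonneg (by positivity)]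
  calc _ ≤ ((M : ℝ) / ρ) ^ 2 * (((ρ : ℝ) ^ 4 - ρ ^ 2) / 12 * (Y / M ^ 4)) := by gcongr
    _ ≤ ((M : ℝ) / ρ) ^ 2 * ((ρ : ℝ) ^ 4 / 12 * (Y / M ^ 4)) := by
      gcongr
      have : (0 : ℝ) ≤ (ρ : ℝ) ^ 2 := by positivity
      linarith
    _ = _ := by field_simp

theorem abs_interp_sub_le {M ρ : ℕ} (hM : 0 < M) (hρ : 0 < ρ) {z : ℤ → ℝ} {Y : ℝ}
    (h : ∀ t, |(diff2 M 1).apply z t| ≤ Y) (t : ℤ) :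
    |(interp ρ).apply z t - z t| ≤ ((ρ : ℝ) / M) ^ 2 / 8 * Y := by
  have hM' : (0 : ℝ) < M := by exact_mod_cast hM
  have hρ' : (0 : ℝ) < ρ := by exact_mod_cast hρ
  have hY : 0 ≤ Y := (abs_nonneg _).trans (h 0)
  set X : ℝ := Y / M ^ 2 with hX
  have hXY : Y = M ^ 2 * X := by rw [hX]; field_simp
  have h2 : ∀ t, |z (t + 1) - 2 * z t + z (t - 1)| ≤ X := by
    intro s
    have := h s
    simp only [diff2_apply, Nat.cast_one, div_one, abs_mul] at this
    rw [abs_of_pos (by positivity), hXY] at this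
    exact le_of_mul_le_mul_left this (by positivity)
  obtain ⟨s, hs⟩ := Int.eq_ofNat_of_zero_le (Int.emod_nonneg t (by positivity : (ρ : ℤ) ≠ 0))
  have hsρ : s < ρ := by
    have := Int.emod_lt_of_pos t (by positivity : (0 : ℤ) < ρ)
    omega
  obtain ⟨m, rfl⟩ := Nat.exists_eq_add_of_le hsρ.le
  have fwd : ∀ c : ℝ, |c| = 1 →
      0 ≤ (m : ℝ) * (m - 1) / 2 * X - c * (z (t + m) - z t - m * (z (t + 1) - z t)) := by
    intro c hc
    refine nonneg_of_second_diff_nonneg (e := fun m : ℕ => (m : ℝ) * (m - 1) / 2 * X -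
      c * (z (t + m) - z t - m * (z (t + 1) - z t))) ?_ ?_ ?_ m
    · simp
    · simp
    · intro r
      have a1 := (le_abs_self _).trans ((abs_mul c _).trans_le
        (mul_le_mul hc.le (h2 (t + r + 1)) (abs_nonneg _) zero_le_one))
      push_cast
      rw [show t + (r + 2 : ℤ) = t + r + 1 + 1 by ring, show t + (r + 1 : ℤ) = t + r + 1 by ring]
      rw [show t + r + 1 - 1 = t + (r : ℤ) by ring] at a1
      linarith
  have bwd : ∀ c : ℝ, |c| = 1 →
      0 ≤ (s : ℝ) * (s + 1) / 2 * X - c * (z (t - s) - z t + s * (z (t + 1) - z t)) := by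
    intro c hc
    refine nonneg_of_second_diff_nonneg (e := fun s : ℕ => (s : ℝ) * (s + 1) / 2 * X -
      c * (z (t - s) - z t + s * (z (t + 1) - z t))) ?_ ?_ ?_ s
    · simp
    · have a1 := (le_abs_self _).trans ((abs_mul c _).trans_le
        (mul_le_mul hc.le (h2 t) (abs_nonneg _) zero_le_one))
      simp
      linarith
    · intro r
      have a1 := (le_abs_self _).trans ((abs_mul c _).trans_le
        (mul_le_mul hc.le (h2 (t - r - 1)) (abs_nonneg _) zero_le_one))
      push_cast
      rw [show t - (r + 2 : ℤ) = t - r - 1 - 1 by ring, show t - (r + 1 : ℤ) = t - r - 1 by ring]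
      rw [show t - r - 1 + 1 = t - (r : ℤ) by ring] at a1
      linarith
  have f1 := fwd 1 (by simp)
  have f2 := fwd (-1) (by simp)
  have b1 := bwd 1 (by simp)
  have b2 := bwd (-1) (by simp)
  set F := z (t + m) - z t - m * (z (t + 1) - z t) with hF
  set B := z (t - s) - z t + s * (z (t + 1) - z t) with hB
  have hsm : (0 : ℝ) < s + m := by exact_mod_cast hρ
  have e : (interp (s + m)).apply z t - z t = (m * B + s * F) / (s + m) := by
    rw [interp_apply, hs, hF, hB]
    push_cast
    rw [show t - (s : ℤ) + (s + m) = t + m by ring]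
    field_simp
    ring
  have hs0 : (0 : ℝ) ≤ s := by positivity
  have hm0 : (0 : ℝ) ≤ m := by positivity
  have hX0 : 0 ≤ X := by positivity
  have q : (m : ℝ) * s / 2 * X * (s + m) ≤ (s + m) ^ 2 / 8 * X * (s + m) := by
    have : (m : ℝ) * s / 2 ≤ (s + m) ^ 2 / 8 := by nlinarith [sq_nonneg ((s : ℝ) - m)]
    exact mul_le_mul_of_nonneg_right (mul_le_mul_of_nonneg_right this hX0) hsm.le
  have r : (((s + m : ℕ) : ℝ) / M) ^ 2 / 8 * Y = (s + m) ^ 2 / 8 * X := by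
    rw [hXY]; push_cast; field_simp
  rw [e, r, abs_le, le_div_iff₀ hsm, div_le_iff₀ hsm]
  constructor <;>
  nlinarith [mul_nonneg hm0 b1, mul_nonneg hm0 b2, mul_nonneg hs0 f1, mul_nonneg hs0 f2]

/-! ### Odd periodic sequences -/

/-- `z` is odd and `2M`-periodic. -/
def OddPer (M : ℕ) (z : ℤ → ℝ) : Prop := (∀ t, z (-t) = -z t) ∧ ∀ t, z (t + 2 * M) = z t

theorem OddPer.zero {M : ℕ} {z : ℤ → ℝ} (h : OddPer M z) : z 0 = 0 := by
  have := h.1 0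
  simp at this
  linarith

theorem OddPer.apply_right {M : ℕ} {z : ℤ → ℝ} (h : OddPer M z) : z M = 0 := by
  have h1 := h.1 M
  have h2 := h.2 (-M)
  rw [show (-M + 2 * M : ℤ) = M by ring] at h2
  linarith

theorem OddPer.emod {M : ℕ} {z : ℤ → ℝ} (h : OddPer M z) (t : ℤ) : z (t % (2 * M)) = z t := by
  have hp : Function.Periodic z (2 * M) := h.2
  have := hp.int_mul (t / (2 * M)) (t % (2 * M))
  rw [← this]
  congr 1
  simp only [Int.cast_id]
  rw [mul_comm (t / (2 * M : ℤ))]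
  exact Int.emod_add_mul_ediv t (2 * M)

theorem OddPer.exists_mem_abs_eq {M : ℕ} (hM : 0 < M) {z : ℤ → ℝ} (h : OddPer M z) (t : ℤ) :
    ∃ s : ℤ, 0 ≤ s ∧ s ≤ M ∧ |z s| = |z t| := by
  have h0 : 0 ≤ t % (2 * M) := Int.emod_nonneg _ (by positivity)
  have h1 : t % (2 * M) < 2 * M := Int.emod_lt_of_pos _ (by positivity)
  by_cases hc : t % (2 * M) ≤ M
  · exact ⟨_, h0, hc, by rw [h.emod]⟩
  · refine ⟨2 * M - t % (2 * M), by omega, by omega, ?_⟩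
    rw [← h.emod t, ← abs_neg (z (t % (2 * M))), ← h.1, ← h.2 (-(t % (2 * M)))]
    congr 2
    ring

theorem OddPer.diff2 {M : ℕ} (N ρ : ℕ) {z : ℤ → ℝ} (h : OddPer M z) :
    OddPer M ((diff2 N ρ).apply z) := by
  constructor
  · intro t
    simp only [diff2_apply]
    rw [show -t + (ρ : ℤ) = -(t - ρ) by ring, show -t - (ρ : ℤ) = -(t + ρ) by ring, h.1, h.1, h.1]
    ring
  · intro t
    simp only [diff2_apply]
    rw [show t + 2 * (M : ℤ) + ρ = t + ρ + 2 * M by ring,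
      show t + 2 * (M : ℤ) - ρ = t - ρ + 2 * M by ring, h.2, h.2, h.2]

theorem OddPer.interp {M ρ : ℕ} (hρ : 0 < ρ) (hd : ρ ∣ M) {z : ℤ → ℝ} (h : OddPer M z) :
    OddPer M ((interp ρ).apply z) := by
  have hρ' : (0 : ℝ) < ρ := by exact_mod_cast hρ
  constructor
  · intro t
    by_cases ht : (ρ : ℤ) ∣ t
    · rw [interp_apply_of_dvd z ht, interp_apply_of_dvd z (ht.neg_right), h.1]
    · have e : (-t) % (ρ : ℤ) = ρ - t % ρ := by
        rw [Int.neg_emod, if_neg ht]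
        simp
      simp only [interp_apply, e]
      rw [show -t - (ρ - t % ρ) = -(t - t % ρ + ρ) by ring, h.1,
        show -(t - t % ρ + ρ) + ρ = -(t - t % (ρ : ℤ)) by ring, h.1]
      push_cast
      field_simp
      ring
  · intro t
    have e : (t + 2 * (M : ℤ)) % ρ = t % ρ := by
      obtain ⟨n, rfl⟩ := hd
      push_cast
      rw [show t + 2 * ((ρ : ℤ) * n) = t + ρ * (2 * n) by ring, Int.add_mul_emod_self_left]
    simp only [interp_apply, e]
    rw [show t + 2 * (M : ℤ) - t % ρ = t - t % ρ + 2 * M by ring, h.2,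
      show t - t % ρ + 2 * (M : ℤ) + ρ = t - t % ρ + ρ + 2 * M by ring, h.2]

/-! ### Discrete maximum principle -/

theorem le_of_discrete_poisson {d : ℕ} (n : Fin d → ℕ) (γ : Fin d → ℝ) (hγ : ∀ k, 0 ≤ γ k)
    (l : Fin d) (hn : 0 < n l) (hl : γ l = (n l : ℝ) ^ 2) (φ : (Fin d → ℤ) → ℝ) (G : ℝ) (hG : 0 ≤ G)
    (hbdry : ∀ i : Fin d → ℤ, (∀ k, 0 ≤ i k ∧ i k ≤ n k) → (∃ k, i k = 0 ∨ i k = n k) → φ i = 0)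
    (hint : ∀ i : Fin d → ℤ, (∀ k, 0 < i k ∧ i k < n k) →
      -G ≤ ∑ k, γ k * (φ (Function.update i k (i k + 1)) - 2 * φ i +
        φ (Function.update i k (i k - 1))))
    (i : Fin d → ℤ) (hi : ∀ k, 0 ≤ i k ∧ i k ≤ n k) : φ i ≤ G / 8 := by
  refine le_of_forall_pos_le_add fun ε hε => ?_
  have hγl : 0 < γ l := by
    rw [hl]
    positivity
  set b : (Fin d → ℤ) → ℝ := fun j => (j l : ℝ) * (n l - j l) / 2 / γ l with hb
  set ψ : (Fin d → ℤ) → ℝ := fun j => φ j - (G + ε) * b j with hψ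
  have hb0 : ∀ j : Fin d → ℤ, (∀ k, 0 ≤ j k ∧ j k ≤ n k) → 0 ≤ b j := by
    intro j hj
    have h0 : (0 : ℝ) ≤ j l := by exact_mod_cast (hj l).1
    have h1 : (j l : ℝ) ≤ n l := by exact_mod_cast (hj l).2
    have : 0 ≤ (n l : ℝ) - j l := by linarith
    positivity
  have hb8 : ∀ j : Fin d → ℤ, b j ≤ 1 / 8 := by
    intro j
    rw [hb]
    simp only
    rw [div_le_iff₀ hγl, hl]
    nlinarith [sq_nonneg ((n l : ℝ) - 2 * j l)]
  have hbl : ∀ j : Fin d → ℤ, ∑ k, γ k * (b (Function.update j k (j k + 1)) - 2 * b j +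
      b (Function.update j k (j k - 1))) = -1 := by
    intro j
    rw [Finset.sum_eq_single l]
    · simp only [hb, Function.update_self]
      push_cast
      field_simp
      ring
    · intro k _ hk
      simp only [hb, Function.update_of_ne hk.symm]
      ring
    · simp
  obtain ⟨p, hp, hmax⟩ := Finset.exists_max_image
    (Finset.Icc (0 : Fin d → ℤ) (fun k => (n k : ℤ))) ψ
    ⟨i, Finset.mem_Icc.2 ⟨fun k => (hi k).1, fun k => (hi k).2⟩⟩
  rw [Finset.mem_Icc] at hp
  have hp' : ∀ k, 0 ≤ p k ∧ p k ≤ n k := fun k => ⟨hp.1 k, hp.2 k⟩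
  have hmax' : ∀ j : Fin d → ℤ, (∀ k, 0 ≤ j k ∧ j k ≤ n k) → ψ j ≤ ψ p := fun j hj =>
    hmax j (Finset.mem_Icc.2 ⟨fun k => (hj k).1, fun k => (hj k).2⟩)
  have hψp : ψ p ≤ 0 := by
    by_cases hpb : ∃ k, p k = 0 ∨ p k = n k
    · have := hb0 p hp'
      simp only [hψ, hbdry p hp' hpb]
      nlinarith
    · push Not at hpb
      have hpi : ∀ k, 0 < p k ∧ p k < n k := fun k =>
        ⟨lt_of_le_of_ne (hp' k).1 (hpb k).1.symm, lt_of_le_of_ne (hp' k).2 (hpb k).2⟩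
      exfalso
      have hshift : ∀ (k : Fin d) (t : ℤ), 0 ≤ t → t ≤ n k → ψ (Function.update p k t) ≤ ψ p := by
        intro k t h0 h1
        refine hmax' _ fun k' => ?_
        by_cases h : k' = k
        · subst h; simpa using ⟨h0, h1⟩
        · simpa [Function.update_of_ne h] using hp' k'
      have hle : ∑ k, γ k * (ψ (Function.update p k (p k + 1)) - 2 * ψ p +
          ψ (Function.update p k (p k - 1))) ≤ 0 := by
        refine Finset.sum_nonpos fun k _ => mul_nonpos_of_nonneg_of_nonpos (hγ k) ?_
        have h1 := hshift k (p k + 1) (by linarith [(hpi k).1]) (by linarith [(hpi k).2])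
        have h2 := hshift k (p k - 1) (by linarith [(hpi k).1]) (by linarith [(hpi k).2])
        linarith
      have heq : ∑ k, γ k * (ψ (Function.update p k (p k + 1)) - 2 * ψ p +
          ψ (Function.update p k (p k - 1))) =
          ∑ k, γ k * (φ (Function.update p k (p k + 1)) - 2 * φ p +
            φ (Function.update p k (p k - 1))) - (G + ε) *
          ∑ k, γ k * (b (Function.update p k (p k + 1)) - 2 * b p +
            b (Function.update p k (p k - 1))) := by
        rw [Finset.mul_sum, ← Finset.sum_sub_distrib]
        refine Finset.sum_congr rfl fun k _ => ?_
        simp only [hψ]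
        ring
      rw [heq, hbl] at hle
      linarith [hint p hpi]
  have h1 := (hmax' i hi).trans hψp
  have h2 := hb8 i
  simp only [hψ] at h1
  nlinarith

theorem abs_le_of_discrete_poisson {d : ℕ} (n : Fin d → ℕ) (γ : Fin d → ℝ) (hγ : ∀ k, 0 ≤ γ k)
    (l : Fin d) (hn : 0 < n l) (hl : γ l = (n l : ℝ) ^ 2) (φ : (Fin d → ℤ) → ℝ) (G : ℝ) (hG : 0 ≤ G)
    (hbdry : ∀ i : Fin d → ℤ, (∀ k, 0 ≤ i k ∧ i k ≤ n k) → (∃ k, i k = 0 ∨ i k = n k) → φ i = 0)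
    (hint : ∀ i : Fin d → ℤ, (∀ k, 0 < i k ∧ i k < n k) →
      |∑ k, γ k * (φ (Function.update i k (i k + 1)) - 2 * φ i +
        φ (Function.update i k (i k - 1)))| ≤ G)
    (i : Fin d → ℤ) (hi : ∀ k, 0 ≤ i k ∧ i k ≤ n k) : |φ i| ≤ G / 8 := by
  refine abs_le'.2 ⟨le_of_discrete_poisson n γ hγ l hn hl φ G hG hbdry
    (fun j hj => neg_le_of_abs_le (hint j hj)) i hi, ?_⟩
  refine le_of_discrete_poisson n γ hγ l hn hl (fun j => -φ j) G hG
    (fun j hj hj' => by simp [hbdry j hj hj']) (fun j hj => ?_) i hi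
  have := le_of_abs_le (hint j hj)
  have e : ∑ k, γ k * (-φ (Function.update j k (j k + 1)) - 2 * -φ j +
        -φ (Function.update j k (j k - 1))) = -∑ k, γ k * (φ (Function.update j k (j k + 1)) -
        2 * φ j + φ (Function.update j k (j k - 1))) := by
    rw [← Finset.sum_neg_distrib]
    exact Finset.sum_congr rfl fun k _ => by ring
  rw [e]
  linarith

/-! ### Odd periodic grid functions -/

/-- Grid functions that are odd and `2M`-periodic in every coordinate. -/
def GridOdd (M : ℕ) {d : ℕ} (w : (Fin d → ℤ) → ℝ) : Prop :=
  ∀ (k : Fin d) (i : Fin d → ℤ), OddPer M (fun t => w (Function.update i k t))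

theorem GridOdd.sum_smul {M d : ℕ} {ι : Type*} (s : Finset ι) (c : ι → ℝ)
    (f : ι → (Fin d → ℤ) → ℝ) (h : ∀ a ∈ s, GridOdd M (f a)) :
    GridOdd M (∑ a ∈ s, c a • f a) := by
  intro k i
  constructor
  · intro t
    simp only [Finset.sum_apply, Pi.smul_apply, smul_eq_mul, ← Finset.sum_neg_distrib]
    exact Finset.sum_congr rfl fun a ha => by
      have := (h a ha k i).1 t
      simp only at this
      rw [this]
      ring
  · intro t
    simp only [Finset.sum_apply, Pi.smul_apply, smul_eq_mul]
    exact Finset.sum_congr rfl fun a ha => by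
      have := (h a ha k i).2 t
      simp only at this
      rw [this]

theorem GridOdd.op {M d : ℕ} {σ : Stencil} (hσ : ∀ z, OddPer M z → OddPer M (σ.apply z))
    {w : (Fin d → ℤ) → ℝ} (hw : GridOdd M w) (k : Fin d) : GridOdd M (σ.op k w) := by
  intro j i
  by_cases h : j = k
  · subst h
    rw [Stencil.op_line]
    exact hσ _ (hw j i)
  · constructor
    · intro t
      simp only [Stencil.op_line_of_ne σ h, ← Finset.sum_neg_distrib]
      exact Finset.sum_congr rfl fun m _ => by
        have := (hw j (Function.update i k (σ.node m (i k)))).1 t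
        simp only at this
        rw [this]
        ring
    · intro t
      simp only [Stencil.op_line_of_ne σ h]
      exact Finset.sum_congr rfl fun m _ => by
        have := (hw j (Function.update i k (σ.node m (i k)))).2 t
        simp only at this
        rw [this]

theorem GridOdd.eq_zero {M d : ℕ} {w : (Fin d → ℤ) → ℝ} (hw : GridOdd M w) {i : Fin d → ℤ}
    (h : ∃ k, i k = 0 ∨ i k = M) : w i = 0 := by
  obtain ⟨k, h | h⟩ := h
  · simpa [← h] using (hw k i).zero
  · simpa [← h] using (hw k i).apply_right

theorem GridOdd.exists_mem_abs_eq {M d : ℕ} (hM : 0 < M) {w : (Fin d → ℤ) → ℝ} (hw : GridOdd M w)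
    (i : Fin d → ℤ) : ∃ j : Fin d → ℤ, (∀ k, 0 ≤ j k ∧ j k ≤ M) ∧ |w j| = |w i| := by
  suffices H : ∀ s : Finset (Fin d), ∃ j : Fin d → ℤ, (∀ k ∈ s, 0 ≤ j k ∧ j k ≤ M) ∧
      |w j| = |w i| by
    obtain ⟨j, hj, e⟩ := H Finset.univ
    exact ⟨j, fun k => hj k (Finset.mem_univ k), e⟩
  intro s
  induction s using Finset.induction_on with
  | empty => exact ⟨i, by simp, rfl⟩
  | insert a s ha ih =>
    obtain ⟨j, hj, e⟩ := ih
    obtain ⟨t, h0, h1, ht⟩ := (hw a j).exists_mem_abs_eq hM (j a)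
    refine ⟨Function.update j a t, fun k hk => ?_, ?_⟩
    · by_cases h : k = a
      · subst h; simpa using ⟨h0, h1⟩
      · simpa [Function.update_of_ne h] using hj k ((Finset.mem_insert.1 hk).resolve_left h)
    · rw [ht, Function.update_eq_self, e]

theorem abs_op_interp_le {d ρ : ℕ} (hρ : 0 < ρ) (k : Fin d) {w : (Fin d → ℤ) → ℝ} {B : ℝ}
    (h : ∀ i, |w i| ≤ B) (i : Fin d → ℤ) : |(interp ρ).op k w i| ≤ B := by
  rw [Stencil.op_eq_apply]
  exact abs_interp_le hρ (fun t => h _) _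

/-- Interpolation inside the box only uses values inside the box. -/
theorem interp_nodes_mem {M ρ : ℕ} (hρ : 0 < ρ) (hd : ρ ∣ M) {t : ℤ} (h0 : 0 ≤ t) (h1 : t ≤ M)
    (ht : ¬ (ρ : ℤ) ∣ t) : (0 ≤ t - t % ρ ∧ t - t % ρ ≤ M) ∧
      (0 ≤ t - t % ρ + ρ ∧ t - t % ρ + ρ ≤ M) := by
  have hρ' : (0 : ℤ) < ρ := by exact_mod_cast hρ
  have a0 : 0 ≤ t % ρ := Int.emod_nonneg _ hρ'.ne'
  have a2 : t - t % ρ = ρ * (t / ρ) := by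
    have := Int.emod_add_mul_ediv t ρ
    linarith
  have a3 : 0 ≤ t / ρ := Int.ediv_nonneg h0 hρ'.le
  have a5 : t % ρ ≠ 0 := fun h => ht (Int.dvd_of_emod_eq_zero h)
  obtain ⟨n, hn⟩ := hd
  have hn' : (M : ℤ) = ρ * n := by exact_mod_cast hn
  have a6 : t / ρ < n := by
    by_contra hc
    push Not at hc
    have : (ρ : ℤ) * n ≤ ρ * (t / ρ) := by gcongr
    omega
  have a7 : (ρ : ℤ) * (t / ρ + 1) ≤ ρ * n := by gcongr; omega
  have a8 : 0 ≤ (ρ : ℤ) * (t / ρ) := by positivity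
  rw [mul_add, mul_one] at a7
  omega

theorem abs_op_interp_le_of_box {d M ρ : ℕ} (hρ : 0 < ρ) (hd : ρ ∣ M) (k : Fin d)
    {w : (Fin d → ℤ) → ℝ} {B : ℝ} {i : Fin d → ℤ} (h0 : 0 ≤ i k) (h1 : i k ≤ M)
    (h : ∀ t : ℤ, 0 ≤ t → t ≤ M → (ρ : ℤ) ∣ t → |w (Function.update i k t)| ≤ B) :
    |(interp ρ).op k w i| ≤ B := by
  rw [Stencil.op_eq_apply]
  by_cases ht : (ρ : ℤ) ∣ i k
  · rw [interp_apply_of_dvd _ ht]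
    exact h _ h0 h1 ht
  · rw [interp_apply]
    obtain ⟨w0, w1⟩ := interp_weight_mem hρ (i k)
    obtain ⟨b1, b2⟩ := interp_nodes_mem hρ hd h0 h1 ht
    exact abs_convexComb_le w0 w1 (h _ b1.1 b1.2 (interp_dvd_node _ _))
      (h _ b2.1 b2.2 ((interp_dvd_node _ _).add (dvd_refl _)))

/-- The discrete Laplacian in the directions `s` with steps `ρ k / M`. -/
noncomputable def lap (M : ℕ) {d : ℕ} (ρ : Fin d → ℕ) (s : Finset (Fin d)) :
    Module.End ℝ ((Fin d → ℤ) → ℝ) := ∑ k ∈ s, (diff2 M (ρ k)).op k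

/-- Odd periodic grid functions which are determined by interpolation from the lattice `ρ`. -/
def latticeSpace (M : ℕ) {d : ℕ} (ρ : Fin d → ℕ) : Submodule ℝ ((Fin d → ℤ) → ℝ) where
  carrier := {w | GridOdd M w ∧ ∀ k, (interp (ρ k)).op k w = w}
  add_mem' := by
    rintro v w ⟨hv, hv'⟩ ⟨hw, hw'⟩
    refine ⟨?_, fun k => by rw [map_add, hv', hw']⟩
    have := GridOdd.sum_smul (M := M) (d := d) Finset.univ (fun _ : Bool => 1)
      (fun b => if b then v else w) (by simp [hv, hw])
    simpa using this
  zero_mem' := by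
    refine ⟨fun k i => ⟨fun t => by simp, fun t => by simp⟩, fun k => map_zero _⟩
  smul_mem' := by
    rintro c w ⟨hw, hw'⟩
    refine ⟨?_, fun k => by rw [map_smul, hw']⟩
    have := GridOdd.sum_smul (M := M) (d := d) Finset.univ (fun _ : Unit => c)
      (fun _ => w) (by simp [hw])
    simpa using this

theorem op_interp_one {d : ℕ} (k : Fin d) (w : (Fin d → ℤ) → ℝ) : (interp 1).op k w = w := by
  ext i
  rw [Stencil.op_eq_apply, interp_one, Function.update_eq_self]

theorem lattice_max_principle {M d : ℕ} (hM : 0 < M) {ρ : Fin d → ℕ} (hd : ∀ k, ρ k ∣ M)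
    {s : Finset (Fin d)} (hs : s.Nonempty) {w : (Fin d → ℤ) → ℝ} (hw : w ∈ latticeSpace M ρ)
    {G : ℝ} (hG : ∀ i, |lap M ρ s w i| ≤ G) (i : Fin d → ℤ) : |w i| ≤ G / 8 := by
  classical
  have hG0 : 0 ≤ G := (abs_nonneg _).trans (hG 0)
  have hρ : ∀ k, 0 < ρ k := fun k => Nat.pos_of_dvd_of_pos (hd k) hM
  obtain ⟨hodd, hint⟩ := hw
  have hlat : ∀ i : Fin d → ℤ, (∀ k, 0 ≤ i k ∧ i k ≤ M) → (∀ k, (ρ k : ℤ) ∣ i k) →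
      |w i| ≤ G / 8 := by
    intro i hi hdi
    choose j hj using hdi
    obtain ⟨l, hl⟩ := hs
    choose n hn using hd
    have hφ : w i = (fun j : Fin d → ℤ => w (fun k => ρ k * j k)) j := by
      simp only
      congr 1
      ext k
      exact hj k
    rw [hφ]
    have hjn : ∀ (k : Fin d) (t : ℤ), (0 ≤ (ρ k : ℤ) * t ↔ 0 ≤ t) ∧
        ((ρ k : ℤ) * t ≤ M ↔ t ≤ n k) := by
      intro k t
      have : (0 : ℤ) < ρ k := by exact_mod_cast hρ k
      constructor
      · exact mul_nonneg_iff_of_pos_left this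
      · rw [hn k]
        push_cast
        exact mul_le_mul_iff_right₀ this
    have hMn : ∀ k, (M : ℝ) / ρ k = n k := by
      intro k
      have : (0 : ℝ) < ρ k := by exact_mod_cast hρ k
      rw [div_eq_iff this.ne', mul_comm]
      exact_mod_cast hn k
    refine abs_le_of_discrete_poisson n (fun k => if k ∈ s then ((M : ℝ) / ρ k) ^ 2 else 0)
      (fun k => by split_ifs <;> positivity) l ?_ ?_ (fun j => w (fun k => ρ k * j k)) G hG0 ?_ ?_ j
      (fun k => by rw [← (hjn k (j k)).1, ← (hjn k (j k)).2, ← hj k]; exact hi k)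
    · refine Nat.pos_of_ne_zero fun h => ?_
      rw [hn l, h] at hM
      simp at hM
    · simp only [if_pos hl, hMn]
    · rintro j hj ⟨k, hk⟩
      refine hodd.eq_zero ⟨k, ?_⟩
      rcases hk with hk | hk
      · simp [hk]
      · right
        rw [hk, hn k]
        push_cast
        rfl
    · intro j _
      refine le_of_eq_of_le ?_ (hG (fun k => ρ k * j k))
      congr 1
      simp only [lap, LinearMap.sum_apply, Finset.sum_apply, ite_mul, zero_mul, Finset.sum_ite_mem,
        Finset.univ_inter]
      refine Finset.sum_congr rfl fun k _ => ?_
      have e : ∀ t : ℤ, (fun k' => (ρ k' : ℤ) * Function.update j k t k') =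
          Function.update (fun k' => (ρ k' : ℤ) * j k') k (ρ k * t) := by
        intro t
        ext k'
        by_cases h : k' = k
        · subst h; simp
        · simp [Function.update_of_ne h]
      rw [Stencil.op_eq_apply, diff2_apply, Function.update_eq_self, e, e,
        show (ρ k : ℤ) * (j k + 1) = ρ k * j k + ρ k by ring,
        show (ρ k : ℤ) * (j k - 1) = ρ k * j k - ρ k by ring]
  suffices H : ∀ (t : Finset (Fin d)) (i : Fin d → ℤ), (∀ k, 0 ≤ i k ∧ i k ≤ M) →
      (∀ k, k ∉ t → (ρ k : ℤ) ∣ i k) → |w i| ≤ G / 8 by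
    obtain ⟨j, hj, e⟩ := hodd.exists_mem_abs_eq hM i
    rw [← e]
    exact H Finset.univ j hj (by simp)
  intro t
  induction t using Finset.induction_on with
  | empty => exact fun i hi hdi => hlat i hi fun k => hdi k (by simp)
  | insert a t ha ih =>
    intro i hi hdi
    rw [← hint a]
    refine abs_op_interp_le_of_box (hρ a) (hd a) a (hi a).1 (hi a).2 fun s h0 h1 hs => ih _ ?_ ?_
    · intro k
      by_cases h : k = a
      · subst h; simpa using ⟨h0, h1⟩
      · simpa [Function.update_of_ne h] using hi k
    · intro k hk
      by_cases h : k = a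
      · subst h; simpa using hs
      · simpa [Function.update_of_ne h] using hdi k (by simp [h, hk])

/-! ### Solving the discrete Poisson problem -/

theorem GridOdd.diff2 {M d : ℕ} (N ρ : ℕ) {w : (Fin d → ℤ) → ℝ} (hw : GridOdd M w) (k : Fin d) :
    GridOdd M ((diff2 N ρ).op k w) :=
  hw.op (fun _ h => h.diff2 N ρ) k

theorem GridOdd.interp {M d ρ : ℕ} (hρ : 0 < ρ) (hd : ρ ∣ M) {w : (Fin d → ℤ) → ℝ}
    (hw : GridOdd M w) (k : Fin d) : GridOdd M ((interp ρ).op k w) :=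
  hw.op (fun _ h => h.interp hρ hd) k

theorem GridOdd.mem_latticeSpace_one {M d : ℕ} {w : (Fin d → ℤ) → ℝ} (hw : GridOdd M w) :
    w ∈ latticeSpace M (fun _ : Fin d => 1) :=
  ⟨hw, fun k => op_interp_one k w⟩

theorem GridOdd.abs_le_diff2 {M d : ℕ} (hM : 0 < M) {w : (Fin d → ℤ) → ℝ} (hw : GridOdd M w)
    (k : Fin d) {G : ℝ} (hG : ∀ i, |(PoissonFD.diff2 M 1).op k w i| ≤ G) (i : Fin d → ℤ) :
    |w i| ≤ G / 8 :=
  lattice_max_principle hM (fun _ => one_dvd M) (Finset.singleton_nonempty k)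
    hw.mem_latticeSpace_one (by simpa [lap] using hG) i

theorem commute_interp_diff2 {d : ℕ} (M : ℕ) (ρ : Fin d → ℕ) (j k : Fin d) :
    Commute ((interp (ρ j)).op j) ((diff2 M (ρ k)).op k) := by
  by_cases h : j = k
  · subst h
    exact Stencil.op_commute_of_apply _ _ _ (interp_diff2_comm M (ρ j))
  · exact Stencil.op_commute _ _ h

theorem commute_interp_interp {d : ℕ} (ρ : Fin d → ℕ) (j k : Fin d) :
    Commute ((interp (ρ j)).op j) ((interp (ρ k)).op k) := by
  by_cases h : j = k
  · subst h
    exact Commute.refl _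
  · exact Stencil.op_commute _ _ h

theorem latticeSpace.finite {M d : ℕ} (hM : 0 < M) (ρ : Fin d → ℕ) :
    Module.Finite ℝ (latticeSpace M ρ) := by
  let B : Finset (Fin d → ℤ) := Finset.Icc 0 (fun _ => (M : ℤ))
  let res : latticeSpace M ρ →ₗ[ℝ] (B → ℝ) :=
    { toFun := fun w i => w.1 i
      map_add' := fun _ _ => rfl
      map_smul' := fun _ _ => rfl }
  refine Module.Finite.of_injective res ((injective_iff_map_eq_zero res).2 fun w hw => ?_)
  refine Subtype.ext (funext fun i => ?_)
  obtain ⟨j, hj, e⟩ := w.2.1.exists_mem_abs_eq hM i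
  have : w.1 j = 0 := congrFun hw
    ⟨j, Finset.mem_Icc.2 ⟨fun k => (hj k).1, fun k => (hj k).2⟩⟩
  rw [this, abs_zero] at e
  exact abs_eq_zero.1 e.symm

theorem lap_mem_latticeSpace {M d : ℕ} {ρ : Fin d → ℕ} (s : Finset (Fin d))
    {w : (Fin d → ℤ) → ℝ} (hw : w ∈ latticeSpace M ρ) : lap M ρ s w ∈ latticeSpace M ρ := by
  rw [lap, LinearMap.sum_apply]
  refine Submodule.sum_mem _ fun k _ => ⟨hw.1.diff2 M (ρ k) k, fun j => ?_⟩
  have := LinearMap.congr_fun (commute_interp_diff2 M ρ j k).eq w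
  simp only [Module.End.mul_apply] at this
  rw [this, hw.2 j]

theorem exists_lap_eq {M d : ℕ} (hM : 0 < M) (hd : 0 < d) {ρ : Fin d → ℕ} (hρ : ∀ k, ρ k ∣ M)
    {g : (Fin d → ℤ) → ℝ} (hg : g ∈ latticeSpace M ρ) :
    ∃ w ∈ latticeSpace M ρ, lap M ρ Finset.univ w = g := by
  have := latticeSpace.finite hM ρ
  let L : latticeSpace M ρ →ₗ[ℝ] latticeSpace M ρ :=
    (lap M ρ Finset.univ).restrict fun _ => lap_mem_latticeSpace _
  have hinj : Function.Injective L := by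
    refine (injective_iff_map_eq_zero L).2 fun w hw => Subtype.ext (funext fun i => ?_)
    have h0 : lap M ρ Finset.univ w.1 = 0 := congrArg Subtype.val hw
    have := lattice_max_principle hM hρ ⟨⟨0, hd⟩, Finset.mem_univ _⟩ w.2
      (G := 0) (by simp [h0]) i
    exact abs_nonpos_iff.1 (by linarith)
  obtain ⟨w, hw⟩ := LinearMap.surjective_of_injective hinj ⟨g, hg⟩
  exact ⟨w.1, w.2, congrArg Subtype.val hw⟩

open Classical in
/-- The solution of the discrete Poisson problem on the lattice `ρ` (zero if there is none). -/
noncomputable def solve (M : ℕ) {d : ℕ} (ρ : Fin d → ℕ) (g : (Fin d → ℤ) → ℝ) :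
    (Fin d → ℤ) → ℝ :=
  if h : ∃ w ∈ latticeSpace M ρ, lap M ρ Finset.univ w = g then h.choose else 0

theorem solve_mem {M d : ℕ} (ρ : Fin d → ℕ) (g : (Fin d → ℤ) → ℝ) :
    solve M ρ g ∈ latticeSpace M ρ := by
  unfold solve
  split_ifs with h
  · exact h.choose_spec.1
  · exact Submodule.zero_mem _

theorem lap_solve {M d : ℕ} (hM : 0 < M) (hd : 0 < d) {ρ : Fin d → ℕ} (hρ : ∀ k, ρ k ∣ M)
    {g : (Fin d → ℤ) → ℝ} (hg : g ∈ latticeSpace M ρ) :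
    lap M ρ Finset.univ (solve M ρ g) = g := by
  have h := exists_lap_eq hM hd hρ hg
  rw [solve, dif_pos h]
  exact h.choose_spec.2

/-! ### Products of commuting directional operators -/

section opProd

variable {ι V : Type*} [AddCommGroup V] [Module ℝ V]

/-- Product of a pairwise commuting family of operators over a finite set. -/
def opProd (f : ι → Module.End ℝ V) (hf : Pairwise fun j k => Commute (f j) (f k))
    (s : Finset ι) : Module.End ℝ V :=
  s.noncommProd f fun _ _ _ _ h => hf h

variable {f : ι → Module.End ℝ V} (hf : Pairwise fun j k => Commute (f j) (f k))

theorem opProd_empty : opProd f hf ∅ = 1 := Finset.noncommProd_empty _ _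

theorem opProd_insert [DecidableEq ι] {a : ι} {s : Finset ι} (ha : a ∉ s) :
    opProd f hf (insert a s) = f a * opProd f hf s :=
  Finset.noncommProd_insert_of_notMem _ _ _ _ ha

theorem opProd_commute {y : Module.End ℝ V} {s : Finset ι} (h : ∀ k ∈ s, Commute y (f k)) :
    Commute y (opProd f hf s) :=
  Finset.noncommProd_commute _ _ _ _ h

theorem opProd_congr {g : ι → Module.End ℝ V} (hg : Pairwise fun j k => Commute (g j) (g k))
    {s : Finset ι} (h : ∀ k ∈ s, f k = g k) : opProd f hf s = opProd g hg s :=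
  Finset.noncommProd_congr rfl h _

theorem opProd_apply_eq_self {s : Finset ι} {w : V} (h : ∀ k ∈ s, f k w = w) :
    opProd f hf s w = w := by
  classical
  induction s using Finset.induction_on with
  | empty => rw [opProd_empty, Module.End.one_apply]
  | insert a s ha ih =>
    rw [opProd_insert hf ha, Module.End.mul_apply, ih fun k hk => h k (Finset.mem_insert_of_mem hk),
      h a (Finset.mem_insert_self a s)]

theorem opProd_apply_of_subset [DecidableEq ι] {s t : Finset ι} (hst : s ⊆ t) {w : V}
    (h : ∀ k ∈ t, k ∉ s → f k w = w) : opProd f hf t w = opProd f hf s w := by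
  have e : opProd f hf t = opProd f hf s * opProd f hf (t \ s) := by
    rw [opProd, opProd, opProd, ← Finset.noncommProd_union_of_disjoint disjoint_sdiff_self_right]
    · exact Finset.noncommProd_congr (Finset.union_sdiff_of_subset hst).symm (fun _ _ => rfl) _
  rw [e, Module.End.mul_apply, opProd_apply_eq_self hf (s := t \ s)]
  intro k hk
  rw [Finset.mem_sdiff] at hk
  exact h k hk.1 hk.2

theorem sum_powerset_opProd_sub_one [DecidableEq ι]
    (hf' : Pairwise fun j k => Commute (f j - 1) (f k - 1)) (s : Finset ι) :
    ∑ t ∈ s.powerset, opProd (fun k => f k - 1) hf' t = opProd f hf s := by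
  induction s using Finset.induction_on with
  | empty => simp [opProd_empty]
  | insert a s ha ih =>
    rw [Finset.sum_powerset_insert ha, ih, opProd_insert hf ha]
    have : ∑ t ∈ s.powerset, opProd (fun k => f k - 1) hf' (insert a t) =
        (f a - 1) * ∑ t ∈ s.powerset, opProd (fun k => f k - 1) hf' t := by
      rw [Finset.mul_sum]
      refine Finset.sum_congr rfl fun t ht => opProd_insert hf' fun h => ha ?_
      exact Finset.mem_powerset.1 ht h
    rw [this, ih, sub_mul, one_mul, add_sub_cancel]

end opProd

theorem pairwise_interp {d : ℕ} (ρ : Fin d → ℕ) :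
    Pairwise fun j k => Commute ((interp (ρ j)).op j) ((interp (ρ k)).op k) :=
  fun j k _ => commute_interp_interp ρ j k

theorem pairwise_interp_sub_one {d : ℕ} (ρ : Fin d → ℕ) :
    Pairwise fun j k => Commute ((interp (ρ j)).op j - 1) ((interp (ρ k)).op k - 1) :=
  fun j k _ => ((commute_interp_interp ρ j k).sub_left (Commute.one_left _)).sub_right
    (Commute.one_right _)

theorem pairwise_diff4 {d : ℕ} (M : ℕ) :
    Pairwise fun j k : Fin d => Commute ((diff2 M 1).op j * (diff2 M 1).op j)
      ((diff2 M 1).op k * (diff2 M 1).op k) := fun j k h => by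
  have := Stencil.op_commute (diff2 M 1) (diff2 M 1) h
  exact (this.mul_left this).mul_right (this.mul_left this)

/-- Multilinear interpolation in the directions `s`. -/
noncomputable def interpProd {d : ℕ} (ρ : Fin d → ℕ) (s : Finset (Fin d)) :
    Module.End ℝ ((Fin d → ℤ) → ℝ) :=
  opProd (fun k => (interp (ρ k)).op k) (pairwise_interp ρ) s

/-- Product of the interpolation errors in the directions `s`. -/
noncomputable def interpErr {d : ℕ} (ρ : Fin d → ℕ) (s : Finset (Fin d)) :
    Module.End ℝ ((Fin d → ℤ) → ℝ) :=
  opProd (fun k => (interp (ρ k)).op k - 1) (pairwise_interp_sub_one ρ) s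

/-- Product of the squares of the finest second differences in the directions `s`. -/
noncomputable def diff4Prod (M : ℕ) {d : ℕ} (s : Finset (Fin d)) :
    Module.End ℝ ((Fin d → ℤ) → ℝ) :=
  opProd (fun k => (diff2 M 1).op k * (diff2 M 1).op k) (pairwise_diff4 M) s

theorem interpErr_congr {d : ℕ} {ρ ρ' : Fin d → ℕ} {s : Finset (Fin d)}
    (h : ∀ k ∈ s, ρ k = ρ' k) : interpErr ρ s = interpErr ρ' s :=
  opProd_congr _ _ fun k hk => by rw [h k hk]

theorem abs_interpProd_le {d : ℕ} {ρ : Fin d → ℕ} (hρ : ∀ k, 0 < ρ k) (s : Finset (Fin d))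
    {w : (Fin d → ℤ) → ℝ} {B : ℝ} (h : ∀ i, |w i| ≤ B) (i : Fin d → ℤ) :
    |interpProd ρ s w i| ≤ B := by
  induction s using Finset.induction_on generalizing i with
  | empty => simpa [interpProd, opProd_empty] using h i
  | insert a s ha ih =>
    rw [interpProd, opProd_insert _ ha, Module.End.mul_apply]
    exact abs_op_interp_le (hρ a) a ih i

theorem interpProd_apply_of_dvd {d : ℕ} {ρ : Fin d → ℕ} (s : Finset (Fin d))
    (w : (Fin d → ℤ) → ℝ) {i : Fin d → ℤ} (h : ∀ k ∈ s, (ρ k : ℤ) ∣ i k) :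
    interpProd ρ s w i = w i := by
  induction s using Finset.induction_on with
  | empty => simp [interpProd, opProd_empty]
  | insert a s ha ih =>
    rw [interpProd, opProd_insert _ ha, Module.End.mul_apply, Stencil.op_eq_apply,
      interp_apply_of_dvd _ (h a (Finset.mem_insert_self a s)), Function.update_eq_self]
    exact ih fun k hk => h k (Finset.mem_insert_of_mem hk)

theorem GridOdd.interpProd {M d : ℕ} {ρ : Fin d → ℕ} (hM : 0 < M) (hρ : ∀ k, ρ k ∣ M)
    (s : Finset (Fin d)) {w : (Fin d → ℤ) → ℝ} (hw : GridOdd M w) :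
    GridOdd M (interpProd ρ s w) := by
  induction s using Finset.induction_on with
  | empty => simpa [PoissonFD.interpProd, opProd_empty] using hw
  | insert a s ha ih =>
    rw [PoissonFD.interpProd, opProd_insert _ ha, Module.End.mul_apply]
    exact ih.interp (Nat.pos_of_dvd_of_pos (hρ a) hM) (hρ a) a

theorem interpProd_mem_latticeSpace {M d : ℕ} {ρ : Fin d → ℕ} (hM : 0 < M) (hρ : ∀ k, ρ k ∣ M)
    {w : (Fin d → ℤ) → ℝ} (hw : GridOdd M w) :
    interpProd ρ Finset.univ w ∈ latticeSpace M ρ := by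
  refine ⟨hw.interpProd hM hρ _, fun k => ?_⟩
  have h1 : interpProd ρ Finset.univ =
      (interp (ρ k)).op k * interpProd ρ (Finset.univ.erase k) := by
    have := opProd_insert (pairwise_interp ρ) (Finset.notMem_erase k Finset.univ)
    rwa [Finset.insert_erase (Finset.mem_univ k)] at this
  have h2 : ∀ v : (Fin d → ℤ) → ℝ, (interp (ρ k)).op k ((interp (ρ k)).op k v) =
      (interp (ρ k)).op k v := by
    intro v
    ext i
    rw [Stencil.op_eq_apply, Stencil.op_line, interp_idem, ← Stencil.op_eq_apply]
  rw [h1, Module.End.mul_apply, h2]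

theorem GridOdd.diff4Prod {M d : ℕ} (s : Finset (Fin d)) {w : (Fin d → ℤ) → ℝ}
    (hw : GridOdd M w) : GridOdd M (diff4Prod M s w) := by
  induction s using Finset.induction_on with
  | empty => simpa [PoissonFD.diff4Prod, opProd_empty] using hw
  | insert a s ha ih =>
    rw [PoissonFD.diff4Prod, opProd_insert _ ha, Module.End.mul_apply]
    exact (ih.diff2 M 1 a).diff2 M 1 a

theorem GridOdd.sub {M d : ℕ} {v w : (Fin d → ℤ) → ℝ} (hv : GridOdd M v) (hw : GridOdd M w) :
    GridOdd M (v - w) :=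
  ((latticeSpace M fun _ => 1).sub_mem hv.mem_latticeSpace_one hw.mem_latticeSpace_one).1

theorem GridOdd.interpErr {M d : ℕ} {ρ : Fin d → ℕ} (hM : 0 < M) (hρ : ∀ k, ρ k ∣ M)
    (s : Finset (Fin d)) {w : (Fin d → ℤ) → ℝ} (hw : GridOdd M w) :
    GridOdd M (interpErr ρ s w) := by
  induction s using Finset.induction_on with
  | empty => simpa [PoissonFD.interpErr, opProd_empty] using hw
  | insert a s ha ih =>
    rw [PoissonFD.interpErr, opProd_insert _ ha, Module.End.mul_apply]
    exact (ih.interp (Nat.pos_of_dvd_of_pos (hρ a) hM) (hρ a) a).sub ih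

theorem diff4Prod_commute {M d : ℕ} {s : Finset (Fin d)} {y : Module.End ℝ ((Fin d → ℤ) → ℝ)}
    (h : ∀ k ∈ s, Commute y ((diff2 M 1).op k)) : Commute y (diff4Prod M s) :=
  opProd_commute _ fun k hk => (h k hk).mul_right (h k hk)

/-! ### The hierarchical corrections -/

/-- Step sizes `r` in the directions `T` and the finest step in all others. -/
def mask {d : ℕ} (r : Fin d → ℕ) (T : Finset (Fin d)) (k : Fin d) : ℕ := if k ∈ T then r k else 1

theorem mask_congr {d : ℕ} {r r' : Fin d → ℕ} {T : Finset (Fin d)} (h : ∀ k ∈ T, r k = r' k) :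
    mask r T = mask r' T := by
  ext k
  unfold mask
  split_ifs with hk
  · exact h k hk
  · rfl

theorem mask_dvd {d M : ℕ} {r : Fin d → ℕ} (hr : ∀ k, r k ∣ M) (T : Finset (Fin d)) (k : Fin d) :
    mask r T k ∣ M := by
  unfold mask
  split_ifs
  · exact hr k
  · exact one_dvd M

/-- Difference between the coarse and the finest second difference in direction `k`. -/
noncomputable def trunc (M : ℕ) {d : ℕ} (r : Fin d → ℕ) (k : Fin d) :
    Module.End ℝ ((Fin d → ℤ) → ℝ) := (diff2 M (r k)).op k - (diff2 M 1).op k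

/-- The correction to the grid function `w₀` due to the discretization in the directions `T`. -/
noncomputable def corr (M : ℕ) {d : ℕ} (r : Fin d → ℕ) (w₀ : (Fin d → ℤ) → ℝ)
    (T : Finset (Fin d)) : (Fin d → ℤ) → ℝ :=
  if T = ∅ then w₀ else
    solve M (mask r T) (-interpProd (mask r T) Finset.univ
      (∑ k ∈ T.attach, trunc M r k.1 (corr M r w₀ (T.erase k.1))))
termination_by T.card
decreasing_by exact Finset.card_erase_lt_of_mem k.2

theorem corr_empty {M d : ℕ} (r : Fin d → ℕ) (w₀ : (Fin d → ℤ) → ℝ) : corr M r w₀ ∅ = w₀ := by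
  rw [corr, if_pos rfl]

theorem corr_of_nonempty {M d : ℕ} (r : Fin d → ℕ) (w₀ : (Fin d → ℤ) → ℝ) {T : Finset (Fin d)}
    (hT : T.Nonempty) : corr M r w₀ T = solve M (mask r T) (-interpProd (mask r T) Finset.univ
      (∑ k ∈ T, trunc M r k (corr M r w₀ (T.erase k)))) := by
  rw [corr, if_neg hT.ne_empty, Finset.sum_attach T fun k => trunc M r k (corr M r w₀ (T.erase k))]

theorem corr_congr {M d : ℕ} {r r' : Fin d → ℕ} (w₀ : (Fin d → ℤ) → ℝ) {T : Finset (Fin d)}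
    (h : ∀ k ∈ T, r k = r' k) : corr M r w₀ T = corr M r' w₀ T := by
  induction T using Finset.strongInduction with
  | H T ih =>
    rcases T.eq_empty_or_nonempty with rfl | hT
    · rw [corr_empty, corr_empty]
    · rw [corr_of_nonempty r w₀ hT, corr_of_nonempty r' w₀ hT, mask_congr h]
      congr 3
      refine Finset.sum_congr rfl fun k hk => ?_
      rw [ih _ (Finset.erase_ssubset hk) fun j hj => h j (Finset.mem_of_mem_erase hj), trunc, trunc,
        h k hk]

section

variable {M d : ℕ} (hM : 0 < M) {r : Fin d → ℕ} (hr : ∀ k, r k ∣ M) {w₀ : (Fin d → ℤ) → ℝ}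
  (hw₀ : GridOdd M w₀)

include hw₀ in
theorem corr_mem (T : Finset (Fin d)) : corr M r w₀ T ∈ latticeSpace M (mask r T) := by
  rcases T.eq_empty_or_nonempty with rfl | hT
  · rw [corr_empty]
    refine ⟨hw₀, fun k => ?_⟩
    rw [mask, if_neg (Finset.notMem_empty k), op_interp_one]
  · rw [corr_of_nonempty r w₀ hT]
    exact solve_mem _ _

include hM hr hw₀ in
theorem lap_corr {T : Finset (Fin d)} (hT : T.Nonempty) :
    lap M (mask r T) Finset.univ (corr M r w₀ T) = -interpProd (mask r T) Finset.univ
      (∑ k ∈ T, trunc M r k (corr M r w₀ (T.erase k))) := by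
  rw [corr_of_nonempty r w₀ hT]
  refine lap_solve hM (Fin.pos hT.choose) (mask_dvd hr T) (Submodule.neg_mem _ ?_)
  refine interpProd_mem_latticeSpace hM (mask_dvd hr T) ?_
  have := Submodule.sum_mem (latticeSpace M fun _ : Fin d => 1) (t := T)
    (f := fun k => trunc M r k (corr M r w₀ (T.erase k))) fun k _ => ?_
  · exact this.1
  · have h := (corr_mem hw₀ (r := r) (T.erase k)).1
    exact ((h.diff2 M (r k) k).sub (h.diff2 M 1 k)).mem_latticeSpace_one

theorem commute_trunc_diff2 {j k : Fin d} (h : j ≠ k) :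
    Commute (trunc M r j) ((diff2 M 1).op k) :=
  (Stencil.op_commute _ _ h).sub_left (Stencil.op_commute _ _ h)

include hM hr in
theorem abs_trunc_le (k : Fin d) {w : (Fin d → ℤ) → ℝ} {Y : ℝ}
    (h : ∀ i, |(diff2 M 1).op k ((diff2 M 1).op k w) i| ≤ Y) (i : Fin d → ℤ) :
    |trunc M r k w i| ≤ ((r k : ℝ) / M) ^ 2 / 12 * Y := by
  rw [trunc, LinearMap.sub_apply, Pi.sub_apply, Stencil.op_eq_apply, Stencil.op_eq_apply]
  refine abs_diff2_sub_diff2_le hM (Nat.pos_of_dvd_of_pos (hr k) hM) (fun t => ?_) _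
  have := h (Function.update i k t)
  rw [Stencil.op_eq_apply, Stencil.op_line] at this
  simpa using this

theorem interpProd_mask_commute {A T : Finset (Fin d)} (h : Disjoint A T) (s : Finset (Fin d)) :
    Commute (interpProd (mask r T) s) (diff4Prod M A) := by
  refine diff4Prod_commute fun k hk => (opProd_commute _ fun j _ => ?_).symm
  by_cases hjk : j = k
  · subst hjk
    rw [mask, if_neg (Finset.disjoint_left.1 h hk),
      show (interp 1).op j = (1 : Module.End ℝ ((Fin d → ℤ) → ℝ)) from
        LinearMap.ext (op_interp_one j)]
    exact Commute.one_right _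
  · exact (Stencil.op_commute _ _ hjk).symm

include hM hr hw₀ in
theorem abs_diff4Prod_corr_le {K : ℝ} (hK : ∀ A i, |diff4Prod M A w₀ i| ≤ K)
    (T A : Finset (Fin d)) (h : Disjoint A T) (i : Fin d → ℤ) :
    |diff4Prod M A (corr M r w₀ T) i| ≤
      K * T.card.factorial / 96 ^ T.card * ∏ k ∈ T, ((r k : ℝ) / M) ^ 2 := by
  induction T using Finset.strongInduction generalizing A i with
  | H T ih =>
    rcases T.eq_empty_or_nonempty with rfl | hT
    · simpa [corr_empty] using hK A i
    · have hρ : ∀ k, 0 < mask r T k := fun k => Nat.pos_of_dvd_of_pos (mask_dvd hr T k) hM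
      have hmem := corr_mem hw₀ (r := r) T
      have hlat : diff4Prod M A (corr M r w₀ T) ∈ latticeSpace M (mask r T) := by
        refine ⟨hmem.1.diff4Prod A, fun k => ?_⟩
        have := LinearMap.congr_fun
          (interpProd_mask_commute (M := M) (r := r) h {k}).eq (corr M r w₀ T)
        have e : interpProd (mask r T) {k} = (interp (mask r T k)).op k := by
          rw [interpProd, ← insert_empty_eq, opProd_insert _ (Finset.notMem_empty k),
            opProd_empty, mul_one]
        rw [Module.End.mul_apply, Module.End.mul_apply, e, hmem.2 k] at this
        exact this
      have hlap : lap M (mask r T) Finset.univ (diff4Prod M A (corr M r w₀ T)) =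
          -interpProd (mask r T) Finset.univ
            (∑ k ∈ T, trunc M r k (diff4Prod M A (corr M r w₀ (T.erase k)))) := by
        have c1 : Commute (lap M (mask r T) Finset.univ) (diff4Prod M A) := by
          refine diff4Prod_commute fun k hk => Commute.sum_left _ _ _ fun j _ => ?_
          by_cases hjk : j = k
          · subst hjk
            rw [mask, if_neg (Finset.disjoint_left.1 h hk)]
            exact Commute.refl _
          · exact Stencil.op_commute _ _ hjk
        have c2 : ∀ k ∈ T, trunc M r k (diff4Prod M A (corr M r w₀ (T.erase k))) =
            diff4Prod M A (trunc M r k (corr M r w₀ (T.erase k))) := fun k hk =>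
          LinearMap.congr_fun (diff4Prod_commute (M := M) (s := A) fun j hj =>
            commute_trunc_diff2 (r := r) (j := k) fun hkj =>
              Finset.disjoint_left.1 h hj (hkj ▸ hk)).eq _
        rw [Finset.sum_congr rfl c2, ← map_sum, ← Module.End.mul_apply,
          c1.eq, Module.End.mul_apply, lap_corr hM hr hw₀ hT, map_neg, ← Module.End.mul_apply,
          ← (interpProd_mask_commute (M := M) h _).eq, Module.End.mul_apply]
      set P : ℝ := ∏ k ∈ T, ((r k : ℝ) / M) ^ 2 with hP
      have hm : 0 < T.card := hT.card_pos
      have hterm : ∀ k ∈ T, ∀ i, |trunc M r k (diff4Prod M A (corr M r w₀ (T.erase k))) i| ≤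
          K * (T.card - 1).factorial / 96 ^ (T.card - 1) * P / 12 := by
        intro k hk i
        have hkA : k ∉ A := fun hkA => Finset.disjoint_left.1 h hkA hk
        have := abs_trunc_le hM hr k (w := diff4Prod M A (corr M r w₀ (T.erase k)))
          (fun i => by
            have := ih _ (Finset.erase_ssubset hk) (insert k A) (by
              rw [Finset.disjoint_insert_left]
              exact ⟨Finset.notMem_erase k T, h.mono_right (Finset.erase_subset k T)⟩) i
            rwa [diff4Prod, opProd_insert _ hkA, Module.End.mul_apply, Module.End.mul_apply]
              at this) i
        refine this.trans_eq ?_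
        rw [Finset.card_erase_of_mem hk, hP, ← Finset.mul_prod_erase T _ hk]
        ring
      have hG : ∀ i, |lap M (mask r T) Finset.univ (diff4Prod M A (corr M r w₀ T)) i| ≤
          T.card * (K * (T.card - 1).factorial / 96 ^ (T.card - 1) * P / 12) := by
        intro i
        rw [hlap, Pi.neg_apply, abs_neg]
        refine abs_interpProd_le hρ _ (fun i => ?_) i
        rw [Finset.sum_apply]
        refine (Finset.abs_sum_le_sum_abs _ _).trans ((Finset.sum_le_sum fun k hk =>
          hterm k hk i).trans_eq ?_)
        rw [Finset.sum_const, nsmul_eq_mul]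
      refine (lattice_max_principle hM (mask_dvd hr T) ⟨hT.choose, Finset.mem_univ _⟩ hlat
        hG i).trans_eq ?_
      obtain ⟨m, hm'⟩ := Nat.exists_eq_succ_of_ne_zero hm.ne'
      rw [hm', Nat.succ_sub_one, Nat.factorial_succ, pow_succ]
      push_cast
      field_simp
      ring

include hM hr hw₀ in
theorem abs_interpErr_corr_le {K : ℝ} (hK : ∀ A i, |diff4Prod M A w₀ i| ≤ K)
    (T B A : Finset (Fin d)) (hAT : Disjoint A T) (hBT : Disjoint B T) (hAB : Disjoint A B)
    (i : Fin d → ℤ) : |interpErr r B (diff4Prod M A (corr M r w₀ T)) i| ≤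
      K * T.card.factorial / 96 ^ T.card / 64 ^ B.card *
        ((∏ k ∈ T, ((r k : ℝ) / M) ^ 2) * ∏ k ∈ B, ((r k : ℝ) / M) ^ 2) := by
  induction B using Finset.induction_on generalizing A i with
  | empty => simpa [interpErr, opProd_empty] using abs_diff4Prod_corr_le hM hr hw₀ hK T A hAT i
  | insert k B hk ih =>
    rw [Finset.disjoint_insert_left] at hBT
    rw [Finset.disjoint_insert_right] at hAB
    set y := interpErr r B (diff4Prod M A (corr M r w₀ T)) with hy
    have hodd : GridOdd M y := (((corr_mem hw₀ (r := r) T).1.diff4Prod A)).interpErr hM hr B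
    have h4 : ∀ i, |(diff2 M 1).op k ((diff2 M 1).op k y) i| ≤
        K * T.card.factorial / 96 ^ T.card / 64 ^ B.card *
        ((∏ k ∈ T, ((r k : ℝ) / M) ^ 2) * ∏ k ∈ B, ((r k : ℝ) / M) ^ 2) := by
      intro i
      have := ih (insert k A) (by rw [Finset.disjoint_insert_left]; exact ⟨hBT.1, hAT⟩) hBT.2
        (by rw [Finset.disjoint_insert_left]; exact ⟨hk, hAB.2⟩) i
      have c : Commute ((diff2 M 1).op k) (interpErr r B) := opProd_commute _ fun j hj => by
        have : k ≠ j := fun e => hk (e ▸ hj)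
        exact (Stencil.op_commute _ _ this).sub_right (Commute.one_right _)
      rw [diff4Prod, opProd_insert _ hAB.1, Module.End.mul_apply, ← diff4Prod,
        ← Module.End.mul_apply, ← (c.mul_left c).eq] at this
      exact this
    have h2 := (hodd.diff2 M 1 k).abs_le_diff2 hM k h4
    have e : interpErr r (insert k B) (diff4Prod M A (corr M r w₀ T)) i =
        (interp (r k)).op k y i - y i := by
      rw [interpErr, opProd_insert _ hk, Module.End.mul_apply, ← interpErr, ← hy,
        LinearMap.sub_apply, Module.End.one_apply, Pi.sub_apply]
    have h1 := abs_interp_sub_le hM (Nat.pos_of_dvd_of_pos (hr k) hM)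
      (z := fun t => y (Function.update i k t)) (fun t => by
        have := h2 (Function.update i k t)
        rw [← congrFun (Stencil.op_line (diff2 M 1) k y i) t]
        exact this) (i k)
    rw [← Stencil.op_eq_apply, Function.update_eq_self] at h1
    rw [e]
    refine h1.trans_eq ?_
    rw [Finset.card_insert_of_notMem hk, Finset.prod_insert hk, pow_succ]
    ring

end

/-! ### The discrete error expansion -/

/-- The part of the total error which is attributed to the directions `J`. -/
noncomputable def errTerm (M : ℕ) {d : ℕ} (r : Fin d → ℕ) (w₀ : (Fin d → ℤ) → ℝ)
    (J : Finset (Fin d)) : (Fin d → ℤ) → ℝ :=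
  -∑ T ∈ J.powerset, interpErr r (J \ T) (corr M r w₀ T)

theorem errTerm_congr {M d : ℕ} {r r' : Fin d → ℕ} (w₀ : (Fin d → ℤ) → ℝ) {J : Finset (Fin d)}
    (h : ∀ k ∈ J, r k = r' k) : errTerm M r w₀ J = errTerm M r' w₀ J := by
  unfold errTerm
  congr 1
  refine Finset.sum_congr rfl fun T hT => ?_
  rw [corr_congr w₀ fun k hk => h k (Finset.mem_powerset.1 hT hk),
    interpErr_congr fun k hk => h k (Finset.mem_sdiff.1 hk).1]

theorem sum_choose_factorial_le (m : ℕ) :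
    ∑ t ∈ Finset.range (m + 1), (m.choose t : ℝ) * (t.factorial / 96 ^ t / 64 ^ (m - t)) ≤
      9 * (m.factorial / 96 ^ m) := by
  have e : ∀ t ∈ Finset.range (m + 1),
      (m.choose t : ℝ) * (t.factorial / 96 ^ t / 64 ^ (m - t)) =
        m.factorial / 96 ^ m * ((3 / 2) ^ (m - t) / (m - t).factorial) := by
    intro t ht
    have htm : t ≤ m := Nat.lt_succ_iff.1 (Finset.mem_range.1 ht)
    obtain ⟨s, rfl⟩ := Nat.exists_eq_add_of_le htm
    rw [Nat.add_sub_cancel_left]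
    have h1 : ((t + s).choose t : ℝ) * t.factorial * s.factorial = (t + s).factorial := by
      rw [Nat.choose_symm_add]
      exact_mod_cast Nat.add_choose_mul_factorial_mul_factorial t s
    have h2 : (s.factorial : ℝ) ≠ 0 := by positivity
    have h3 : (96 : ℝ) ^ s = 64 ^ s * (3 / 2) ^ s := by rw [← mul_pow]; norm_num
    rw [← h1, pow_add, h3]
    field_simp
  rw [Finset.sum_congr rfl e, ← Finset.mul_sum, mul_comm]
  have e2 : ∑ t ∈ Finset.range (m + 1), ((3 : ℝ) / 2) ^ (m - t) / (m - t).factorial =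
      ∑ t ∈ Finset.range (m + 1), ((3 : ℝ) / 2) ^ t / t.factorial := by
    rw [← Finset.sum_range_reflect]
    refine Finset.sum_congr rfl fun t ht => ?_
    have htm : t ≤ m := Nat.lt_succ_iff.1 (Finset.mem_range.1 ht)
    rw [show m - (m + 1 - 1 - t) = t by omega]
  rw [e2]
  gcongr
  refine (Real.sum_le_exp_of_nonneg (by norm_num) (m + 1)).trans ?_
  have h1 : Real.exp (3 / 2) ≤ Real.exp 1 ^ 2 := by
    rw [← Real.exp_nat_mul]
    exact Real.exp_le_exp.2 (by norm_num)
  nlinarith [Real.exp_one_lt_d9, Real.exp_pos 1]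

section

variable {M d : ℕ} (hM : 0 < M) {r : Fin d → ℕ} (hr : ∀ k, r k ∣ M) {w₀ : (Fin d → ℤ) → ℝ}
  (hw₀ : GridOdd M w₀)

include hM hr hw₀ in
theorem abs_errTerm_le {K : ℝ} (hK : ∀ A i, |diff4Prod M A w₀ i| ≤ K) (J : Finset (Fin d))
    (i : Fin d → ℤ) : |errTerm M r w₀ J i| ≤
      9 * K * (J.card.factorial / 96 ^ J.card) * ∏ k ∈ J, ((r k : ℝ) / M) ^ 2 := by
  have hK0 : 0 ≤ K := (abs_nonneg _).trans (hK ∅ 0)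
  set P : ℝ := ∏ k ∈ J, ((r k : ℝ) / M) ^ 2 with hP
  have hP0 : 0 ≤ P := Finset.prod_nonneg fun k _ => by positivity
  rw [errTerm, Pi.neg_apply, abs_neg, Finset.sum_apply]
  have hterm : ∀ T ∈ J.powerset, |interpErr r (J \ T) (corr M r w₀ T) i| ≤
      K * P * (T.card.factorial / 96 ^ T.card / 64 ^ (J.card - T.card)) := by
    intro T hT
    rw [Finset.mem_powerset] at hT
    have := abs_interpErr_corr_le hM hr hw₀ hK T (J \ T) ∅ (Finset.disjoint_empty_left _)
      Finset.sdiff_disjoint (Finset.disjoint_empty_left _) i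
    rw [diff4Prod, opProd_empty, Module.End.one_apply, Finset.card_sdiff_of_subset hT,
      mul_comm (∏ k ∈ T, _), Finset.prod_sdiff hT, ← hP] at this
    refine this.trans_eq ?_
    ring
  refine (Finset.abs_sum_le_sum_abs _ _).trans ((Finset.sum_le_sum hterm).trans ?_)
  rw [← Finset.mul_sum, Finset.sum_powerset_apply_card
    (fun t => ((t.factorial : ℝ) / 96 ^ t / 64 ^ (J.card - t)))]
  simp only [nsmul_eq_mul]
  refine (mul_le_mul_of_nonneg_left (sum_choose_factorial_le J.card) (by positivity)).trans_eq ?_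
  ring

include hw₀ in
theorem sum_errTerm : ∑ J ∈ Finset.univ.filter (fun J : Finset (Fin d) => J.Nonempty),
    errTerm M r w₀ J = w₀ - interpProd r Finset.univ (∑ T, corr M r w₀ T) := by
  have h1 : ∑ J : Finset (Fin d), errTerm M r w₀ J =
      -interpProd r Finset.univ (∑ T, corr M r w₀ T) := by
    simp only [errTerm]
    rw [Finset.sum_neg_distrib, map_sum]
    congr 1
    rw [Finset.sum_comm' (s := Finset.univ) (t := fun J : Finset (Fin d) => J.powerset)
      (t' := Finset.univ) (s' := fun T => Finset.univ.filter fun J => T ⊆ J) (by simp)]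
    refine Finset.sum_congr rfl fun T _ => ?_
    have e : ∑ J ∈ Finset.univ.filter (fun J => T ⊆ J), interpErr r (J \ T) (corr M r w₀ T) =
        ∑ B ∈ Tᶜ.powerset, interpErr r B (corr M r w₀ T) := by
      refine Finset.sum_bij' (fun J _ => J \ T) (fun B _ => B ∪ T) ?_ ?_ ?_ ?_ ?_
      · intro J _
        rw [Finset.mem_powerset, Finset.sdiff_eq_inter_compl]
        exact Finset.inter_subset_right
      · intro B _
        simp
      · intro J hJ
        exact Finset.sdiff_union_of_subset (Finset.mem_filter.1 hJ).2
      · intro B hB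
        have : Disjoint B T := by
          rw [Finset.mem_powerset] at hB
          exact Finset.disjoint_left.2 fun k hk hkT => Finset.mem_compl.1 (hB hk) hkT
        rw [Finset.union_sdiff_right]
        exact Finset.sdiff_eq_self_of_disjoint this
      · intro J _
        rfl
    have h2 := LinearMap.congr_fun (sum_powerset_opProd_sub_one (pairwise_interp r)
      (pairwise_interp_sub_one r) Tᶜ) (corr M r w₀ T)
    rw [LinearMap.sum_apply] at h2
    rw [e]
    refine h2.trans (opProd_apply_of_subset _ (Finset.subset_univ _) fun k _ hk => ?_).symm
    have hkT : k ∈ T := by simpa using hk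
    have := (corr_mem hw₀ (r := r) T).2 k
    rwa [mask, if_pos hkT] at this
  have h3 : Finset.univ.filter (fun J : Finset (Fin d) => J.Nonempty) =
      Finset.univ.erase ∅ := by
    ext J
    simp [Finset.nonempty_iff_ne_empty]
  have h4 : errTerm M r w₀ (∅ : Finset (Fin d)) = -w₀ := by
    simp [errTerm, interpErr, opProd_empty, corr_empty]
  have h5 := Finset.add_sum_erase Finset.univ (fun J => errTerm M r w₀ J) (Finset.mem_univ ∅)
  simp only [h1, h4] at h5
  rw [h3, sub_eq_add_neg, ← h5]
  abel

include hM hr hw₀ in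
theorem lap_sum_corr {i : Fin d → ℤ} (hi : ∀ k, (r k : ℤ) ∣ i k) :
    lap M r Finset.univ (∑ T, corr M r w₀ T) i = ∑ k, (diff2 M 1).op k w₀ i := by
  have h1 : ∀ T : Finset (Fin d), lap M (mask r T) Finset.univ (corr M r w₀ T) i =
      (if T = ∅ then ∑ k, (diff2 M 1).op k w₀ i else 0) -
        ∑ k ∈ T, trunc M r k (corr M r w₀ (T.erase k)) i := by
    intro T
    rcases T.eq_empty_or_nonempty with rfl | hT
    · simp [lap, mask, corr_empty]
    · rw [lap_corr hM hr hw₀ hT, if_neg hT.ne_empty, zero_sub, Pi.neg_apply,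
        interpProd_apply_of_dvd, Finset.sum_apply]
      intro k _
      unfold mask
      split_ifs
      · exact hi k
      · simp
  have h2 : ∀ T : Finset (Fin d), lap M r Finset.univ (corr M r w₀ T) i =
      lap M (mask r T) Finset.univ (corr M r w₀ T) i +
        ∑ k ∈ Tᶜ, trunc M r k (corr M r w₀ T) i := by
    intro T
    have e : ∑ k ∈ Tᶜ, trunc M r k (corr M r w₀ T) i =
        ∑ k, if k ∈ Tᶜ then trunc M r k (corr M r w₀ T) i else 0 := by
      rw [Finset.sum_ite_mem, Finset.univ_inter]
    rw [e]
    simp only [lap, LinearMap.sum_apply, Finset.sum_apply]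
    rw [← Finset.sum_add_distrib]
    refine Finset.sum_congr rfl fun k _ => ?_
    by_cases hk : k ∈ T
    · rw [mask, if_pos hk, if_neg fun h => Finset.mem_compl.1 h hk, add_zero]
    · rw [mask, if_neg hk, if_pos (Finset.mem_compl.2 hk), trunc, LinearMap.sub_apply, Pi.sub_apply]
      ring
  rw [map_sum, Finset.sum_apply, Finset.sum_congr rfl fun T _ => (h2 T).trans
    (congrArg (· + _) (h1 T)), Finset.sum_add_distrib, Finset.sum_sub_distrib,
    Finset.sum_ite_eq' Finset.univ ∅, if_pos (Finset.mem_univ _)]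
  have h3 : ∑ T : Finset (Fin d), ∑ k ∈ T, trunc M r k (corr M r w₀ (T.erase k)) i =
      ∑ T : Finset (Fin d), ∑ k ∈ Tᶜ, trunc M r k (corr M r w₀ T) i := by
    rw [Finset.sum_sigma', Finset.sum_sigma']
    refine Finset.sum_bij' (fun p _ => ⟨p.1.erase p.2, p.2⟩) (fun p _ => ⟨insert p.2 p.1, p.2⟩)
      ?_ ?_ ?_ ?_ ?_
    · rintro ⟨T, k⟩ _
      simp
    · rintro ⟨T, k⟩ _
      simp
    · rintro ⟨T, k⟩ h
      have : k ∈ T := (Finset.mem_sigma.1 h).2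
      simp [Finset.insert_erase this]
    · rintro ⟨T, k⟩ h
      have : k ∉ T := Finset.mem_compl.1 (Finset.mem_sigma.1 h).2
      simp [Finset.erase_insert this]
    · rintro ⟨T, k⟩ _
      rfl
  rw [h3]
  ring

include hM hr in
/-- Stability of the interpolated finite difference solution under consistency errors. -/
theorem abs_interpProd_sub_le (hd : 0 < d) {n : Fin d → ℕ} (hn : ∀ k, M = r k * n k)
    {Y G : (Fin d → ℤ) → ℝ} (hY : GridOdd M Y) {U : (Fin d → ℤ) → ℝ} {ε : ℝ} (hε : 0 ≤ ε)
    (hU0 : ∀ j : Fin d → ℤ, (∀ k, 0 ≤ j k ∧ j k ≤ n k) → (∃ k, j k = 0 ∨ j k = n k) → U j = 0)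
    (hUY : ∀ j : Fin d → ℤ, (∀ k, 0 < j k ∧ j k < n k) →
      |lap M r Finset.univ Y (fun k => r k * j k) -
        ∑ k, (n k : ℝ) ^ 2 * (U (Function.update j k (j k + 1)) - 2 * U j +
          U (Function.update j k (j k - 1)))| ≤ ε)
    (hGU : ∀ j : Fin d → ℤ, (∀ k, 0 ≤ j k ∧ j k ≤ n k) → G (fun k => r k * j k) = U j)
    (hG : ∀ (k : Fin d) (i : Fin d → ℤ), (∀ k, 0 ≤ i k ∧ i k ≤ M) → (interp (r k)).op k G i = G i)
    (i : Fin d → ℤ) (hi : ∀ k, 0 ≤ i k ∧ i k ≤ M) :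
    |interpProd r Finset.univ Y i - G i| ≤ ε / 8 := by
  have hr0 : ∀ k, 0 < r k := fun k => Nat.pos_of_dvd_of_pos (hr k) hM
  have hMn : ∀ k, (M : ℝ) / r k = n k := by
    intro k
    have : (0 : ℝ) < r k := by exact_mod_cast hr0 k
    rw [div_eq_iff this.ne', mul_comm]
    exact_mod_cast hn k
  have hlat : ∀ j : Fin d → ℤ, (∀ k, 0 ≤ j k ∧ j k ≤ n k) →
      |Y (fun k => r k * j k) - U j| ≤ ε / 8 := by
    have hn0 : 0 < n ⟨0, hd⟩ := Nat.pos_of_ne_zero fun h => by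
      rw [hn ⟨0, hd⟩, h] at hM
      simp at hM
    refine abs_le_of_discrete_poisson n (fun k => (n k : ℝ) ^ 2) (fun k => by positivity)
      ⟨0, hd⟩ hn0 rfl (fun j => Y (fun k => r k * j k) - U j) ε hε ?_ ?_
    · rintro j hj ⟨k, hk⟩
      rw [hU0 j hj ⟨k, hk⟩, sub_zero]
      refine hY.eq_zero ⟨k, ?_⟩
      rcases hk with hk | hk
      · simp [hk]
      · right
        rw [hk, hn k]
        push_cast
        rfl
    · intro j hj
      refine le_of_eq_of_le ?_ (hUY j hj)
      congr 1
      simp only [lap, LinearMap.sum_apply, Finset.sum_apply]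
      rw [← Finset.sum_sub_distrib]
      refine Finset.sum_congr rfl fun k _ => ?_
      have e : ∀ t : ℤ, (fun k' => (r k' : ℤ) * Function.update j k t k') =
          Function.update (fun k' => (r k' : ℤ) * j k') k (r k * t) := by
        intro t
        ext k'
        by_cases h : k' = k
        · subst h; simp
        · simp [Function.update_of_ne h]
      rw [Stencil.op_eq_apply, diff2_apply, Function.update_eq_self, e, e, hMn,
        show (r k : ℤ) * (j k + 1) = r k * j k + r k by ring,
        show (r k : ℤ) * (j k - 1) = r k * j k - r k by ring]
      ring
  suffices H : ∀ (s : Finset (Fin d)) (i : Fin d → ℤ), (∀ k, 0 ≤ i k ∧ i k ≤ M) →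
      (∀ k, k ∉ s → (r k : ℤ) ∣ i k) → |interpProd r s Y i - G i| ≤ ε / 8 from
    H Finset.univ i hi (by simp)
  intro s
  induction s using Finset.induction_on with
  | empty =>
    intro i hi hdi
    choose j hj using fun k => hdi k (Finset.notMem_empty k)
    have hjn : ∀ k, 0 ≤ j k ∧ j k ≤ n k := by
      intro k
      have h0 : (0 : ℤ) < r k := by exact_mod_cast hr0 k
      have h1 : (M : ℤ) = r k * n k := by exact_mod_cast hn k
      have h2 := hi k
      rw [hj k, h1] at h2
      exact ⟨(mul_nonneg_iff_of_pos_left h0).1 h2.1, le_of_mul_le_mul_left h2.2 h0⟩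
    have e : i = fun k => r k * j k := funext hj
    rw [interpProd, opProd_empty, Module.End.one_apply, e, hGU j hjn]
    exact hlat j hjn
  | insert a s ha ih =>
    intro i hi hdi
    have e : interpProd r (insert a s) Y i - G i =
        (interp (r a)).op a (interpProd r s Y - G) i := by
      rw [map_sub, Pi.sub_apply, hG a i hi, interpProd, opProd_insert _ ha, Module.End.mul_apply]
      rfl
    rw [e]
    refine abs_op_interp_le_of_box (hr0 a) (hr a) a (hi a).1 (hi a).2 fun t h0 h1 ht => ih _ ?_ ?_
    · intro k
      by_cases h : k = a
      · subst h; simpa using ⟨h0, h1⟩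
      · simpa [Function.update_of_ne h] using hi k
    · intro k hk
      by_cases h : k = a
      · subst h; simpa using ht
      · simpa [Function.update_of_ne h] using hdi k (by simp [h, hk])

end

/-! ### Second differences of smooth functions -/

theorem abs_second_diff_le_of_hasDerivAt {f f' f'' : ℝ → ℝ} (h1 : ∀ y, HasDerivAt f (f' y) y)
    (h2 : ∀ y, HasDerivAt f' (f'' y) y) {B x h : ℝ} (hh : 0 ≤ h)
    (hB : ∀ y, |y - x| ≤ h → |f'' y| ≤ B) :
    |f (x + h) - 2 * f x + f (x - h)| ≤ B * h ^ 2 := by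
  have key : ∀ c : ℝ, |c| = 1 →
      0 ≤ B * h ^ 2 - c * (f (x + h) - 2 * f x + f (x - h)) := by
    intro c hc
    set p : ℝ → ℝ := fun s => B * s ^ 2 - c * (f (x + s) - 2 * f x + f (x - s)) with hp
    have hder : ∀ s, HasDerivAt p (2 * B * s - c * (f' (x + s) - f' (x - s))) s := by
      intro s
      have e1 : HasDerivAt (fun s => f (x + s)) (f' (x + s)) s := (h1 (x + s)).comp_const_add x s
      have e2 : HasDerivAt (fun s => f (x - s)) (-f' (x - s)) s := (h1 (x - s)).comp_const_sub x s
      have := (((hasDerivAt_id' s).pow 2).const_mul B).sub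
        (((e1.sub_const (2 * f x)).add e2).const_mul c)
      refine this.congr_deriv ?_
      simp
      ring
    have hmono : MonotoneOn p (Set.Icc 0 h) := by
      refine monotoneOn_of_deriv_nonneg (convex_Icc 0 h)
        (fun s _ => (hder s).continuousAt.continuousWithinAt)
        (fun s _ => (hder s).differentiableAt.differentiableWithinAt) fun s hs => ?_
      rw [interior_Icc] at hs
      rw [(hder s).deriv]
      have hlip := (convex_Icc (x - s) (x + s)).norm_image_sub_le_of_norm_hasDerivWithin_le
        (f := f') (f' := f'') (C := B) (fun y _ => (h2 y).hasDerivWithinAt)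
        (fun y hy => hB y (abs_le.2 ⟨by linarith [hy.1, hs.2], by linarith [hy.2, hs.2]⟩))
        (Set.left_mem_Icc.2 (by linarith [hs.1])) (Set.right_mem_Icc.2 (by linarith [hs.1]))
      rw [Real.norm_eq_abs, Real.norm_eq_abs, show x + s - (x - s) = 2 * s by ring,
        abs_of_nonneg (by linarith [hs.1] : (0 : ℝ) ≤ 2 * s)] at hlip
      have := (le_abs_self _).trans ((abs_mul c (f' (x + s) - f' (x - s))).trans_le
        (mul_le_mul hc.le hlip (abs_nonneg _) zero_le_one))
      linarith
    have := hmono (Set.left_mem_Icc.2 hh) (Set.right_mem_Icc.2 hh) hh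
    simp only [hp] at this
    have e : f (x + 0) - 2 * f x + f (x - 0) = 0 := by simp; ring
    rw [e] at this
    simpa using this
  have k1 := key 1 (by simp)
  have k2 := key (-1) (by simp)
  rw [abs_le]
  constructor <;> linarith

theorem abs_second_diff_sub_le_of_hasDerivAt {f f' f'' f''' : ℝ → ℝ}
    (h1 : ∀ y, HasDerivAt f (f' y) y) (h2 : ∀ y, HasDerivAt f' (f'' y) y)
    (h3 : ∀ y, HasDerivAt f'' (f''' y) y) {B : ℝ} (hB : ∀ y, |f''' y| ≤ B) (x : ℝ) {h : ℝ}
    (hh : 0 ≤ h) : |f (x + h) - 2 * f x + f (x - h) - h ^ 2 * f'' x| ≤ B * h * h ^ 2 := by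
  have := abs_second_diff_le_of_hasDerivAt (f := fun y => f y - f'' x / 2 * y ^ 2)
    (f' := fun y => f' y - f'' x * y) (f'' := fun y => f'' y - f'' x) (B := B * h) (x := x)
    (fun y => by
      refine ((h1 y).sub (((hasDerivAt_id' y).pow 2).const_mul (f'' x / 2))).congr_deriv ?_
      simp
      ring)
    (fun y => by
      refine ((h2 y).sub ((hasDerivAt_id' y).const_mul (f'' x))).congr_deriv ?_
      simp) hh
    (fun y hy => by
      have := convex_univ.norm_image_sub_le_of_norm_hasDerivWithin_le
        (f := f'') (f' := f''') (C := B) (fun y _ => (h3 y).hasDerivWithinAt)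
        (fun y _ => hB y) (Set.mem_univ x) (Set.mem_univ y)
      rw [Real.norm_eq_abs, Real.norm_eq_abs] at this
      exact this.trans (mul_le_mul_of_nonneg_left hy ((abs_nonneg _).trans (hB x))))
  refine le_of_eq_of_le ?_ this
  congr 1
  ring

/-! ### Odd periodic sampling -/

/-- Sign of the odd periodic extension. -/
noncomputable def oddSign (M : ℕ) (t : ℤ) : ℝ := if t % (2 * M) ≤ M then 1 else -1

/-- The point of `[0,1]` whose value is used by the odd periodic extension. -/
noncomputable def oddNode (M : ℕ) (t : ℤ) : ℝ :=
  if t % (2 * M) ≤ M then ((t % (2 * M) : ℤ) : ℝ) / M else (2 * M - ((t % (2 * M) : ℤ) : ℝ)) / M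

theorem abs_oddSign (M : ℕ) (t : ℤ) : |oddSign M t| = 1 := by
  unfold oddSign
  split_ifs <;> simp

theorem oddSign_of_mem {M : ℕ} (hM : 0 < M) {t : ℤ} (h0 : 0 ≤ t) (h1 : t ≤ M) :
    oddSign M t = 1 := by
  rw [oddSign, Int.emod_eq_of_lt h0 (by omega), if_pos h1]

theorem oddNode_of_mem {M : ℕ} (hM : 0 < M) {t : ℤ} (h0 : 0 ≤ t) (h1 : t ≤ M) :
    oddNode M t = t / M := by
  rw [oddNode, Int.emod_eq_of_lt h0 (by omega), if_pos h1]

theorem oddPer_sample {M : ℕ} (hM : 0 < M) {φ : ℝ → ℝ} (h0 : φ 0 = 0) (h1 : φ 1 = 0) :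
    OddPer M (fun t => oddSign M t * φ (oddNode M t)) := by
  have hM' : (0 : ℝ) < M := by exact_mod_cast hM
  constructor
  · intro t
    have m0 : 0 ≤ t % (2 * M) := Int.emod_nonneg _ (by positivity)
    have m1 : t % (2 * M) < 2 * M := Int.emod_lt_of_pos _ (by positivity)
    simp only [oddSign, oddNode]
    by_cases hd : (2 * M : ℤ) ∣ t
    · simp [Int.emod_eq_zero_of_dvd hd, Int.emod_eq_zero_of_dvd hd.neg_right, h0]
    · have e : (-t) % (2 * M : ℤ) = 2 * M - t % (2 * M) := by
        rw [Int.neg_emod, if_neg hd]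
        congr 1
      have hne : t % (2 * M : ℤ) ≠ 0 := fun h => hd (Int.dvd_of_emod_eq_zero h)
      rw [e]
      rcases lt_trichotomy (t % (2 * M : ℤ)) M with h | h | h
      · rw [if_neg (by omega), if_neg (by omega), if_pos h.le, if_pos h.le]
        push_cast
        rw [sub_sub_cancel]
        ring
      · rw [h, show (2 * M - M : ℤ) = M by ring]
        simp [hM'.ne', h1]
      · rw [if_pos (by omega), if_pos (by omega), if_neg (by omega), if_neg (by omega)]
        push_cast
        ring
  · intro t
    have e : (t + 2 * (M : ℤ)) % (2 * M) = t % (2 * M) := by simp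
    simp only [oddSign, oddNode, e]

theorem sample_eq_reflect {M : ℕ} (hM : 0 < M) {φ : ℝ → ℝ} (h0 : ∀ s ≤ 0, φ s = 0)
    (h1 : ∀ s, 1 ≤ s → φ s = 0) {t : ℤ} (ht0 : -M ≤ t) (ht1 : t ≤ 2 * M) :
    oddSign M t * φ (oddNode M t) =
      φ (t / M) - φ (-(t / M : ℝ)) - φ (2 - t / M) := by
  have hM' : (0 : ℝ) < M := by exact_mod_cast hM
  have c0 : ∀ {a b : ℤ}, a ≤ b → (a : ℝ) ≤ b := fun h => by exact_mod_cast h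
  by_cases a1 : t < 0
  · have a1' : (t : ℝ) ≤ 0 := by exact_mod_cast a1.le
    have e : t % (2 * M : ℤ) = t + 2 * M := by
      rw [← Int.add_emod_right]
      exact Int.emod_eq_of_lt (by omega) (by omega)
    have v1 : φ (t / M) = 0 := h0 _ (div_nonpos_of_nonpos_of_nonneg a1' hM'.le)
    have v2 : φ (2 - t / M) = 0 := h1 _ (by
      have := div_nonpos_of_nonpos_of_nonneg a1' hM'.le
      linarith)
    rw [v1, v2, oddSign, oddNode, e]
    by_cases a2 : t = -M
    · rw [a2, if_pos (by omega), if_pos (by omega)]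
      push_cast
      rw [show (-M + 2 * M : ℝ) = M by ring, neg_div, div_self hM'.ne', neg_neg, h1 1 le_rfl]
      ring
    · rw [if_neg (by omega), if_neg (by omega)]
      push_cast
      rw [show (2 * M - (t + 2 * M) : ℝ) / M = -(t / M) by ring]
      ring
  · by_cases a2 : t ≤ M
    · have a0' : (0 : ℝ) ≤ t := by exact_mod_cast not_lt.1 a1
      have a2' : (t : ℝ) ≤ M := by exact_mod_cast a2
      have v1 : φ (-(t / M : ℝ)) = 0 := h0 _ (neg_nonpos.2 (by positivity))
      have v2 : φ (2 - t / M) = 0 := h1 _ (by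
        have : (t : ℝ) / M ≤ 1 := (div_le_one hM').2 a2'
        linarith)
      rw [v1, v2, oddSign_of_mem hM (not_lt.1 a1) a2, oddNode_of_mem hM (not_lt.1 a1) a2]
      ring
    · have a2' : (M : ℝ) ≤ t := by exact_mod_cast (not_le.1 a2).le
      have v1 : φ (-(t / M : ℝ)) = 0 := h0 _ (neg_nonpos.2 (by
        have : (0 : ℝ) ≤ t := hM'.le.trans a2'
        positivity))
      have v2 : φ (t / M) = 0 := h1 _ ((one_le_div hM').2 a2')
      rw [v1, v2]
      by_cases a3 : t = 2 * M
      · rw [a3, oddSign, oddNode]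
        push_cast
        rw [show (2 - 2 * M / M : ℝ) = 0 by field_simp; ring, h0 0 le_rfl]
        simp [h0]
      · have e : t % (2 * M : ℤ) = t := Int.emod_eq_of_lt (by omega) (by omega)
        rw [oddSign, oddNode, e, if_neg a2, if_neg a2,
          show (2 * M - t : ℝ) / M = 2 - t / M by field_simp]
        ring

theorem abs_diff4_sample_le {M : ℕ} (hM : 2 ≤ M) {φ : ℕ → ℝ → ℝ}
    (hφ : ∀ m < 4, ∀ s, HasDerivAt (φ m) (φ (m + 1) s) s) (h0 : ∀ m ≤ 4, ∀ s ≤ 0, φ m s = 0)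
    (h1 : ∀ m ≤ 4, ∀ s, 1 ≤ s → φ m s = 0) {B : ℝ} (hB : ∀ s, |φ 4 s| ≤ B) (t : ℤ) :
    |(diff2 M 1).apply ((diff2 M 1).apply fun t => oddSign M t * φ 0 (oddNode M t)) t| ≤ B := by
  have hM0 : 0 < M := by omega
  have hM' : (0 : ℝ) < M := by exact_mod_cast hM0
  have hodd : OddPer M (fun t => oddSign M t * φ 0 (oddNode M t)) :=
    oddPer_sample hM0 (h0 0 (by norm_num) 0 le_rfl) (h1 0 (by norm_num) 1 le_rfl)
  obtain ⟨s, s0, s1, e⟩ := ((hodd.diff2 M 1).diff2 M 1).exists_mem_abs_eq hM0 t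
  rw [← e]
  set ψ : ℕ → ℝ → ℝ := fun m y => φ m y - (-1) ^ m * φ m (-y) - (-1) ^ m * φ m (2 - y) with hψ
  have hψd : ∀ m < 4, ∀ y, HasDerivAt (ψ m) (ψ (m + 1) y) y := by
    intro m hm y
    have e1 : HasDerivAt (fun y => φ m (-y)) (-φ (m + 1) (-y)) y := by
      simpa using (hφ m hm (0 - y)).comp_const_sub 0 y
    have e2 : HasDerivAt (fun y => φ m (2 - y)) (-φ (m + 1) (2 - y)) y :=
      (hφ m hm (2 - y)).comp_const_sub 2 y
    refine (((hφ m hm y).sub (e1.const_mul ((-1) ^ m))).sub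
      (e2.const_mul ((-1) ^ m))).congr_deriv ?_
    simp only [hψ, pow_succ]
    ring
  have hψB : ∀ y, |ψ 4 y| ≤ B := by
    intro y
    simp only [hψ]
    by_cases a1 : y ≤ 0
    · rw [h0 4 le_rfl y a1, h1 4 le_rfl (2 - y) (by linarith)]
      simpa using hB (-y)
    · by_cases a2 : y ≤ 1
      · rw [h0 4 le_rfl (-y) (by linarith), h1 4 le_rfl (2 - y) (by linarith)]
        simpa using hB y
      · rw [h0 4 le_rfl (-y) (by linarith), h1 4 le_rfl y (by linarith)]
        simpa using hB (2 - y)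
  set z : ℤ → ℝ := fun t => oddSign M t * φ 0 (oddNode M t) with hz
  have hzψ : ∀ t : ℤ, -M ≤ t → t ≤ 2 * M → z t = ψ 0 (t / M) := by
    intro t t0 t1
    rw [hz]
    simp only [hψ, pow_zero, one_mul]
    exact sample_eq_reflect hM0 (h0 0 (by norm_num)) (h1 0 (by norm_num)) t0 t1
  set h : ℝ := 1 / M with hh
  have hh0 : 0 ≤ h := by positivity
  have g1 : ∀ m, m < 4 → ∀ y, HasDerivAt
      (fun y => ψ m (y + h) - 2 * ψ m y + ψ m (y - h))
      (ψ (m + 1) (y + h) - 2 * ψ (m + 1) y + ψ (m + 1) (y - h)) y := fun m hm y =>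
    (((hψd m hm (y + h)).comp_add_const y h).sub ((hψd m hm y).const_mul 2)).add
      ((hψd m hm (y - h)).comp_sub_const y h)
  have key := abs_second_diff_le_of_hasDerivAt (g1 0 (by norm_num)) (g1 1 (by norm_num))
    (B := B * h ^ 2) (x := s / M) hh0 fun y _ =>
      abs_second_diff_le_of_hasDerivAt (hψd 2 (by norm_num)) (hψd 3 (by norm_num)) hh0
        fun y _ => hψB y
  have c1 : ∀ t : ℤ, ((t + 1 : ℤ) : ℝ) / M = t / M + h := by
    intro t; push_cast; rw [hh]; ring
  have c2 : ∀ t : ℤ, ((t - 1 : ℤ) : ℝ) / M = t / M - h := by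
    intro t; push_cast; rw [hh]; ring
  have hsm : ∀ t : ℤ, s - 1 ≤ t → t ≤ s + 1 → (diff2 M 1).apply z t =
      M ^ 2 * (ψ 0 (t / M + h) - 2 * ψ 0 (t / M) + ψ 0 (t / M - h)) := by
    intro t t0 t1
    rw [diff2_apply, Nat.cast_one, Nat.cast_one, div_one, hzψ _ (by omega) (by omega),
      hzψ _ (by omega) (by omega), hzψ _ (by omega) (by omega), c1, c2]
  rw [diff2_apply, Nat.cast_one, Nat.cast_one, div_one, hsm _ (by omega) (by omega),
    hsm _ (by omega) (by omega), hsm _ (by omega) (by omega), c1, c2]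
  rw [show ∀ a b c : ℝ, (M : ℝ) ^ 2 * ((M : ℝ) ^ 2 * a - 2 * ((M : ℝ) ^ 2 * b) +
      (M : ℝ) ^ 2 * c) = (M : ℝ) ^ 4 * (a - 2 * b + c) by intros; ring, abs_mul,
      abs_of_pos (by positivity)]
  calc _ ≤ (M : ℝ) ^ 4 * (B * h ^ 2 * h ^ 2) := by gcongr
    _ = B := by rw [hh]; field_simp

/-! ### Sampling of smooth functions -/

/-- A family `F α` of mixed derivatives of order at most four in each direction, all of which
vanish outside the open unit cube and are bounded by `K`. -/
structure DerivFamily {d : ℕ} (K : ℝ) (F : (Fin d → ℕ) → (Fin d → ℝ) → ℝ) : Prop where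
  bound : ∀ α, (∀ j, α j ≤ 4) → ∀ x, |F α x| ≤ K
  vanish : ∀ α, (∀ j, α j ≤ 4) → ∀ x k, x k ≤ 0 ∨ 1 ≤ x k → F α x = 0
  deriv : ∀ α, (∀ j, α j ≤ 4) → ∀ a, α a < 4 → (∀ j < a, α j = 0) → ∀ x,
    HasDerivAt (fun s => F α (Function.update x a s)) (F (Function.update α a (α a + 1)) x) (x a)

theorem DerivFamily.hasDerivAt {d : ℕ} {K : ℝ} {F : (Fin d → ℕ) → (Fin d → ℝ) → ℝ}
    (hF : DerivFamily K F) {α : Fin d → ℕ} (hα : ∀ j, α j ≤ 4) {a : Fin d}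
    (h0 : ∀ j < a, α j = 0) {m : ℕ} (hm : m < 4) (x : Fin d → ℝ) (s : ℝ) :
    HasDerivAt (fun s => F (Function.update α a m) (Function.update x a s))
      (F (Function.update α a (m + 1)) (Function.update x a s)) s := by
  have := hF.deriv (Function.update α a m) (fun j => ?_) a (by simpa using hm)
    (fun j hj => by simpa [Function.update_of_ne hj.ne] using h0 j hj) (Function.update x a s)
  · simpa using this
  · by_cases h : j = a
    · subst h; simpa using hm.le
    · simpa [Function.update_of_ne h] using hα j

/-- Grid function obtained by odd periodic sampling in the directions `T`; the other coordinates
are frozen at `x`. -/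
noncomputable def sample (M : ℕ) {d : ℕ} (T : Finset (Fin d)) (F : (Fin d → ℝ) → ℝ)
    (x : Fin d → ℝ) (i : Fin d → ℤ) : ℝ :=
  (∏ j ∈ T, oddSign M (i j)) * F (fun k => if k ∈ T then oddNode M (i k) else x k)

theorem abs_sample_le {M d : ℕ} (T : Finset (Fin d)) {F : (Fin d → ℝ) → ℝ} {K : ℝ}
    (h : ∀ x, |F x| ≤ K) (x : Fin d → ℝ) (i : Fin d → ℤ) : |sample M T F x i| ≤ K := by
  rw [sample, abs_mul, Finset.abs_prod, Finset.prod_congr rfl fun j _ => abs_oddSign M (i j),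
    Finset.prod_const_one, one_mul]
  exact h _

theorem sample_update {M d : ℕ} {T : Finset (Fin d)} {a : Fin d} (ha : a ∈ T)
    (F : (Fin d → ℝ) → ℝ) (x : Fin d → ℝ) (i : Fin d → ℤ) (t : ℤ) :
    sample M T F x (Function.update i a t) = oddSign M t *
      sample M (T.erase a) F (Function.update x a (oddNode M t)) i := by
  have e1 : ∏ j ∈ T.erase a, oddSign M (Function.update i a t j) =
      ∏ j ∈ T.erase a, oddSign M (i j) :=
    Finset.prod_congr rfl fun j hj => by rw [Function.update_of_ne (Finset.ne_of_mem_erase hj)]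
  rw [sample, sample, ← Finset.mul_prod_erase T _ ha, e1, Function.update_self, mul_assoc]
  congr 3
  ext k
  by_cases h : k = a
  · subst h; simp [ha]
  · simp [h]

theorem sample_frozen {M d : ℕ} {T : Finset (Fin d)} {a : Fin d} (ha : a ∉ T)
    (F : (Fin d → ℝ) → ℝ) (x : Fin d → ℝ) (i : Fin d → ℤ) (s : ℝ) :
    sample M T F (Function.update x a s) i = (∏ j ∈ T, oddSign M (i j)) *
      F (Function.update (fun k => if k ∈ T then oddNode M (i k) else x k) a s) := by
  rw [sample]
  congr 2
  ext k
  by_cases h : k = a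
  · subst h; simp [ha]
  · simp [h]

theorem gridOdd_sample {M d : ℕ} (hM : 0 < M) {F : (Fin d → ℝ) → ℝ}
    (h : ∀ x k, x k ≤ 0 ∨ 1 ≤ x k → F x = 0) (x : Fin d → ℝ) :
    GridOdd M (sample M Finset.univ F x) := by
  intro a i
  simp only [sample_update (Finset.mem_univ a)]
  have ha : a ∉ Finset.univ.erase a := Finset.notMem_erase a _
  refine oddPer_sample hM (φ := fun s => sample M (Finset.univ.erase a) F
    (Function.update x a s) i) ?_ ?_
  · rw [sample_frozen ha, h _ a (by simp), mul_zero]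
  · rw [sample_frozen ha, h _ a (by simp), mul_zero]

theorem sample_univ_of_mem {M d : ℕ} (hM : 0 < M) (F : (Fin d → ℝ) → ℝ) (x : Fin d → ℝ)
    {i : Fin d → ℤ} (hi : ∀ k, 0 ≤ i k ∧ i k ≤ M) :
    sample M Finset.univ F x i = F fun k => (i k : ℝ) / M := by
  rw [sample, Finset.prod_eq_one fun j _ => oddSign_of_mem hM (hi j).1 (hi j).2, one_mul]
  congr 1
  ext k
  simp [oddNode_of_mem hM (hi k).1 (hi k).2]

theorem hasDerivAt_op {d : ℕ} (σ : Stencil) (k : Fin d) {V : ℝ → (Fin d → ℤ) → ℝ}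
    {V' : (Fin d → ℤ) → ℝ} {s : ℝ} (h : ∀ i, HasDerivAt (fun s => V s i) (V' i) s)
    (i : Fin d → ℤ) : HasDerivAt (fun s => σ.op k (V s) i) (σ.op k V' i) s := by
  simp only [Stencil.op_apply]
  exact HasDerivAt.fun_sum fun m _ => (h _).const_mul _

theorem hasDerivAt_diff4Prod {M d : ℕ} (A : Finset (Fin d)) {V : ℝ → (Fin d → ℤ) → ℝ}
    {V' : (Fin d → ℤ) → ℝ} {s : ℝ} (h : ∀ i, HasDerivAt (fun s => V s i) (V' i) s)
    (i : Fin d → ℤ) : HasDerivAt (fun s => diff4Prod M A (V s) i) (diff4Prod M A V' i) s := by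
  induction A using Finset.induction_on generalizing i with
  | empty => simpa [diff4Prod, opProd_empty] using h i
  | insert a A ha ih =>
    simp only [diff4Prod, opProd_insert _ ha, Module.End.mul_apply]
    exact hasDerivAt_op _ a (hasDerivAt_op _ a ih) i

theorem op_update_of_separated {d : ℕ} (σ : Stencil) {a k : Fin d} (hk : a ≠ k)
    {V V' : (Fin d → ℤ) → ℝ} {t : ℤ} {c : ℝ} (h : ∀ i, V (Function.update i a t) = c * V' i)
    (i : Fin d → ℤ) : σ.op k V (Function.update i a t) = c * σ.op k V' i := by
  simp only [Stencil.op_line_of_ne σ hk, h, Stencil.op_apply, Finset.mul_sum]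
  exact Finset.sum_congr rfl fun m _ => by ring

theorem diff4Prod_update_of_separated {M d : ℕ} {A : Finset (Fin d)} {a : Fin d} (ha : a ∉ A)
    {V V' : (Fin d → ℤ) → ℝ} {t : ℤ} {c : ℝ} (h : ∀ i, V (Function.update i a t) = c * V' i)
    (i : Fin d → ℤ) :
    diff4Prod M A V (Function.update i a t) = c * diff4Prod M A V' i := by
  induction A using Finset.induction_on generalizing i with
  | empty => simpa [diff4Prod, opProd_empty] using h i
  | insert b A hb ih =>
    have hab : a ≠ b := fun e => ha (e ▸ Finset.mem_insert_self b A)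
    simp only [diff4Prod, opProd_insert _ hb, Module.End.mul_apply]
    exact op_update_of_separated _ hab (op_update_of_separated _ hab
      (ih fun h => ha (Finset.mem_insert_of_mem h))) i

theorem abs_diff4Prod_sample_le {M d : ℕ} (hM : 2 ≤ M) {K : ℝ}
    {F : (Fin d → ℕ) → (Fin d → ℝ) → ℝ} (hF : DerivFamily K F) (A : Finset (Fin d)) :
    ∀ (T : Finset (Fin d)), A ⊆ T → ∀ (x : Fin d → ℝ) (α : Fin d → ℕ), (∀ j, α j ≤ 4) →
      (∀ a ∈ A, ∀ j ≤ a, α j = 0) → ∀ i, |diff4Prod M A (sample M T (F α) x) i| ≤ K := by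
  induction A using Finset.induction_on_max with
  | empty =>
    intro T _ x α hα _ i
    simpa [diff4Prod, opProd_empty] using abs_sample_le T (hF.bound α hα) x i
  | insert a A hmax ih =>
    intro T hT x α hα h0 i
    have ha : a ∉ A := fun h => lt_irrefl _ (hmax a h)
    have haT : a ∈ T := hT (Finset.mem_insert_self a A)
    have haE : a ∉ T.erase a := Finset.notMem_erase a T
    have hα' : ∀ m ≤ 4, ∀ j, Function.update α a m j ≤ 4 := by
      intro m hm j
      by_cases h : j = a
      · subst h; simpa using hm
      · simpa [Function.update_of_ne h] using hα j
    have hα0 : ∀ j ≤ a, α j = 0 := h0 a (Finset.mem_insert_self a A)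
    set Φ : ℕ → ℝ → ℝ := fun m s => diff4Prod M A
      (sample M (T.erase a) (F (Function.update α a m)) (Function.update x a s)) i with hΦ
    have hzero : ∀ m ≤ 4, ∀ s, s ≤ 0 ∨ 1 ≤ s → Φ m s = 0 := by
      intro m hm s hs
      have : sample M (T.erase a) (F (Function.update α a m)) (Function.update x a s) = 0 := by
        ext j
        rw [sample_frozen haE, hF.vanish _ (hα' m hm) _ a (by simpa using hs), mul_zero]
        rfl
      simp only [hΦ]
      rw [this, map_zero]
      rfl
    have key := abs_diff4_sample_le hM (φ := Φ) (B := K)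
      (fun m hm s => hasDerivAt_diff4Prod A (fun j => by
        simp only [sample_frozen haE]
        exact (hF.hasDerivAt hα (fun j hj => hα0 j hj.le) hm _ s).const_mul _) i)
      (fun m hm s hs => hzero m hm s (Or.inl hs)) (fun m hm s hs => hzero m hm s (Or.inr hs))
      (fun s => ih (T.erase a) (fun b hb => Finset.mem_erase.2
          ⟨fun e => ha (e ▸ hb), hT (Finset.mem_insert_of_mem hb)⟩) _ _ (hα' 4 le_rfl)
        (fun b hb j hj => by
          have hjb : j < a := hj.trans_lt (hmax b hb)
          rw [Function.update_of_ne hjb.ne]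
          exact hα0 j hjb.le) i) (i a)
    have hline : (fun t => diff4Prod M A (sample M T (F α) x) (Function.update i a t)) =
        fun t => oddSign M t * Φ 0 (oddNode M t) := by
      ext t
      rw [diff4Prod_update_of_separated ha (fun j => sample_update haT (F α) x j t) i]
      simp only [hΦ]
      rw [← hα0 a le_rfl, Function.update_eq_self]
    rw [diff4Prod, opProd_insert _ ha, Module.End.mul_apply, Module.End.mul_apply,
      Stencil.op_eq_apply, Stencil.op_line, ← diff4Prod, hline]
    exact key

/-- Consistency of the second difference quotient. -/
theorem abs_diff2_sample_sub_le {M d : ℕ} (hM : 0 < M) {K : ℝ}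
    {F : (Fin d → ℕ) → (Fin d → ℝ) → ℝ} (hF : DerivFamily K F) (x : Fin d → ℝ) (k : Fin d)
    {i : Fin d → ℤ} (hi : ∀ k, 0 < i k ∧ i k < M) :
    |(diff2 M 1).op k (sample M Finset.univ (F 0) x) i -
      F (Function.update 0 k 2) (fun k => (i k : ℝ) / M)| ≤ K / M := by
  have hM' : (0 : ℝ) < M := by exact_mod_cast hM
  set p : Fin d → ℝ := fun k => (i k : ℝ) / M with hp
  have hval : ∀ t : ℤ, 0 ≤ t → t ≤ M →
      sample M Finset.univ (F 0) x (Function.update i k t) =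
        F (Function.update 0 k 0) (Function.update p k ((t : ℝ) / M)) := by
    intro t t0 t1
    rw [sample_univ_of_mem hM]
    · congr 1
      · exact (Function.update_eq_self k (0 : Fin d → ℕ)).symm
      · ext j
        by_cases h : j = k
        · subst h; simp
        · simp [Function.update_of_ne h, hp]
    · intro j
      by_cases h : j = k
      · subst h; simpa using ⟨t0, t1⟩
      · simpa [Function.update_of_ne h] using ⟨(hi j).1.le, (hi j).2.le⟩
  have hd := fun m (hm : m < 4) s => hF.hasDerivAt (α := 0) (a := k) (fun j => by simp)
    (fun j _ => rfl) hm p s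
  have key := abs_second_diff_sub_le_of_hasDerivAt (hd 0 (by norm_num)) (hd 1 (by norm_num))
    (hd 2 (by norm_num)) (B := K) (fun y => hF.bound _ (fun j => by
      by_cases h : j = k
      · subst h; simp
      · simp [Function.update_of_ne h]) _) (p k) (h := 1 / M) (by positivity)
  rw [Function.update_eq_self] at key
  have hik := hi k
  rw [Stencil.op_eq_apply, diff2_apply, Nat.cast_one, Nat.cast_one, div_one,
    hval _ (by omega) (by omega), hval _ (by omega) (by omega), hval _ (by omega) (by omega)]
  have c1 : ((i k + 1 : ℤ) : ℝ) / M = p k + 1 / M := by push_cast; simp only [hp]; ring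
  have c2 : ((i k - 1 : ℤ) : ℝ) / M = p k - 1 / M := by push_cast; simp only [hp]; ring
  rw [c1, c2]
  change |(M : ℝ) ^ 2 * (_ - 2 * F (Function.update 0 k 0) (Function.update p k (p k)) + _) - _| ≤ _
  rw [Function.update_eq_self]
  set a := F (Function.update 0 k 0) (Function.update p k (p k + 1 / M))
  set b := F (Function.update 0 k 0) p
  set c := F (Function.update 0 k 0) (Function.update p k (p k - 1 / M))
  set q := F (Function.update 0 k (1 + 1)) p
  have e : (M : ℝ) ^ 2 * (a - 2 * b + c) - q =
      (M : ℝ) ^ 2 * (a - 2 * b + c - (1 / M) ^ 2 * q) := by field_simp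
  rw [e, abs_mul, abs_of_pos (by positivity)]
  calc _ ≤ (M : ℝ) ^ 2 * (K * (1 / M) * (1 / M) ^ 2) := by gcongr
    _ = K / M := by field_simp

/-! ### Zero extensions of the mixed derivatives -/

theorem foldr_pd_congr {d : ℕ} {α β : Fin d → ℕ} {l : List (Fin d)} (h : ∀ j ∈ l, α j = β j)
    (u : (Fin d → ℝ) → ℝ) :
    l.foldr (fun i v => (pd d i)^[α i] v) u = l.foldr (fun i v => (pd d i)^[β i] v) u := by
  induction l with
  | nil => rfl
  | cons b l ih =>
    simp only [List.foldr_cons]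
    rw [ih fun j hj => h j (List.mem_cons_of_mem b hj), h b List.mem_cons_self]

theorem foldr_pd_update {d : ℕ} {α : Fin d → ℕ} {a : Fin d} {l : List (Fin d)}
    (hl : l.Pairwise (· < ·)) (ha : a ∈ l) (h0 : ∀ j < a, α j = 0) (u : (Fin d → ℝ) → ℝ) :
    l.foldr (fun i v => (pd d i)^[Function.update α a (α a + 1) i] v) u =
      pd d a (l.foldr (fun i v => (pd d i)^[α i] v) u) := by
  induction l with
  | nil => simp at ha
  | cons b l ih =>
    rw [List.pairwise_cons] at hl
    simp only [List.foldr_cons]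
    by_cases hab : a = b
    · subst hab
      rw [foldr_pd_congr (β := α) fun j hj => Function.update_of_ne (hl.1 j hj).ne' _ _,
        Function.update_self, Function.iterate_succ_apply']
    · have hal : a ∈ l := (List.mem_cons.1 ha).resolve_left hab
      have hb : α b = 0 := h0 b (hl.1 a hal)
      rw [Function.update_of_ne (Ne.symm hab), hb, ih hl.2 hal]
      rfl

theorem mderiv_update {d : ℕ} {α : Fin d → ℕ} {a : Fin d} (h0 : ∀ j < a, α j = 0)
    (u : (Fin d → ℝ) → ℝ) :
    mderiv d (Function.update α a (α a + 1)) u = pd d a (mderiv d α u) :=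
  foldr_pd_update (List.pairwise_lt_finRange d) (List.mem_finRange a) h0 u

theorem mderiv_zero {d : ℕ} (u : (Fin d → ℝ) → ℝ) : mderiv d 0 u = u := by
  simp [mderiv]

theorem mderiv_update_two {d : ℕ} (k : Fin d) (u : (Fin d → ℝ) → ℝ) :
    mderiv d (Function.update 0 k 2) u = pd d k (pd d k u) := by
  have h1 : mderiv d (Function.update 0 k 1) u = pd d k u := by
    simpa [mderiv_zero] using mderiv_update (α := 0) (a := k) (fun _ _ => rfl) u
  have h2 := mderiv_update (α := Function.update 0 k 1) (a := k)
    (fun j hj => by simp [Function.update_of_ne hj.ne]) u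
  rw [h1] at h2
  simpa using h2

/-- The mixed derivative of order `α`, extended by zero outside the unit cube. -/
noncomputable def extDeriv {d : ℕ} (u : (Fin d → ℝ) → ℝ) (α : Fin d → ℕ) : (Fin d → ℝ) → ℝ :=
  (unitCube d).indicator (mderiv d α u)

theorem mem_unitCube {d : ℕ} {x : Fin d → ℝ} : x ∈ unitCube d ↔ ∀ k, 0 ≤ x k ∧ x k ≤ 1 :=
  ⟨fun h k => ⟨h.1 k, h.2 k⟩, fun h => ⟨fun k => (h k).1, fun k => (h k).2⟩⟩

theorem hasDerivAt_of_zero_outside {f : ℝ → ℝ} {f' t : ℝ} (h0 : ∀ s, s ≤ 0 ∨ 1 ≤ s → f s = 0)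
    (h' : t ≤ 0 ∨ 1 ≤ t → f' = 0)
    (hd : t ∈ Set.Icc (0 : ℝ) 1 → HasDerivWithinAt f f' (Set.Icc 0 1) t) :
    HasDerivAt f f' t := by
  have hzero : ∀ s : Set ℝ, (∀ y ∈ s, y ≤ 0 ∨ 1 ≤ y) → (t ≤ 0 ∨ 1 ≤ t) →
      HasDerivWithinAt f f' s t := by
    intro s hs ht
    rw [h' ht]
    exact (hasDerivWithinAt_const t s (0 : ℝ)).congr (fun y hy => h0 y (hs y hy)) (h0 t ht)
  rcases lt_trichotomy t 0 with ht | ht | ht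
  · exact (hzero (Set.Iic 0) (fun y hy => Or.inl hy) (Or.inl ht.le)).hasDerivAt (Iic_mem_nhds ht)
  · have := (hzero (Set.Iic 0) (fun y hy => Or.inl hy) (Or.inl ht.le)).union
      (hd ⟨ht.ge, by linarith⟩)
    refine this.hasDerivAt ?_
    filter_upwards [Iio_mem_nhds (show t < 1 by linarith)] with y hy
    rcases le_total y 0 with h | h
    · exact Or.inl h
    · exact Or.inr ⟨h, hy.le⟩
  · rcases lt_trichotomy t 1 with h1 | h1 | h1
    · exact (hd ⟨ht.le, h1.le⟩).hasDerivAt (Icc_mem_nhds ht h1)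
    · have := (hzero (Set.Ici 1) (fun y hy => Or.inr hy) (Or.inr h1.ge)).union
        (hd ⟨ht.le, h1.le⟩)
      refine this.hasDerivAt ?_
      filter_upwards [Ioi_mem_nhds ht] with y hy
      rcases le_total y 1 with h | h
      · exact Or.inr ⟨hy.le, h⟩
      · exact Or.inl h
    · exact (hzero (Set.Ici 1) (fun y hy => Or.inr hy) (Or.inr h1.le)).hasDerivAt (Ici_mem_nhds h1)

theorem extDeriv_eq_zero {d : ℕ} {K : ℝ} {u : (Fin d → ℝ) → ℝ} (hu : MemXb d 4 K u)
    {α : Fin d → ℕ} (hα : ∀ j, α j ≤ 4) {x : Fin d → ℝ} {k : Fin d} (hx : x k ≤ 0 ∨ 1 ≤ x k) :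
    extDeriv u α x = 0 := by
  by_cases h : x ∈ unitCube d
  · rw [extDeriv, Set.indicator_of_mem h]
    have hk := mem_unitCube.1 h k
    exact (hu.1.2 α hα).2 x ⟨h, k, hx.imp (fun e => le_antisymm e hk.1) fun e => le_antisymm hk.2 e⟩
  · rw [extDeriv, Set.indicator_of_notMem h]

theorem derivFamily_extDeriv {d : ℕ} {K : ℝ} (hK : 0 ≤ K) {u : (Fin d → ℝ) → ℝ}
    (hu : MemXb d 4 K u) : DerivFamily K (extDeriv u) where
  bound α hα x := by
    by_cases h : x ∈ unitCube d
    · rw [extDeriv, Set.indicator_of_mem h]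
      exact hu.2 α hα x h
    · rwa [extDeriv, Set.indicator_of_notMem h, abs_zero]
  vanish α hα x k hx := extDeriv_eq_zero hu hα hx
  deriv α hα a ha h0 x := by
    have hα' : ∀ j, Function.update α a (α a + 1) j ≤ 4 := by
      intro j
      by_cases h : j = a
      · subst h; simpa using ha
      · simpa [Function.update_of_ne h] using hα j
    by_cases hx : ∃ k, k ≠ a ∧ (x k ≤ 0 ∨ 1 ≤ x k)
    · obtain ⟨k, hk, hxk⟩ := hx
      rw [extDeriv_eq_zero hu hα' hxk]
      refine (hasDerivAt_const (x a) (0 : ℝ)).congr_of_eventuallyEq (.of_forall fun s => ?_)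
      exact extDeriv_eq_zero hu hα (k := k) (by rwa [Function.update_of_ne hk])
    · push Not at hx
      refine hasDerivAt_of_zero_outside
        (fun s hs => extDeriv_eq_zero hu hα (k := a) (by simpa using hs))
        (fun h => extDeriv_eq_zero hu hα' h) fun ht => ?_
      have hmem : ∀ s ∈ Set.Icc (0 : ℝ) 1, Function.update x a s ∈ unitCube d := by
        intro s hs
        refine mem_unitCube.2 fun k => ?_
        by_cases h : k = a
        · subst h; simpa using hs
        · rw [Function.update_of_ne h]
          exact ⟨(hx k h).1.le, (hx k h).2.le⟩
      have hxm : x ∈ unitCube d := by simpa using hmem (x a) ht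
      have hd := (hu.1.1 α hα a ha x hxm).hasDerivWithinAt
      have hval : extDeriv u (Function.update α a (α a + 1)) x =
          derivWithin (fun t => mderiv d α u (Function.update x a t)) (Set.Icc 0 1) (x a) := by
        rw [extDeriv, Set.indicator_of_mem hxm, mderiv_update h0]
        rfl
      rw [hval]
      refine hd.congr (fun s hs => ?_) ?_
      · rw [extDeriv, Set.indicator_of_mem (hmem s hs)]
      · rw [extDeriv, Set.indicator_of_mem (hmem _ ht)]

open Filter Topology

/-! ### The interpolated finite difference solution -/

/-- Polynomial of degree at most one in each variable. -/
noncomputable def multilinearPoly {d : ℕ} (c : Finset (Fin d) → ℝ) (x : Fin d → ℝ) : ℝ :=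
  ∑ T : Finset (Fin d), c T * ∏ k ∈ T, x k

theorem continuous_multilinearPoly {d : ℕ} (c : Finset (Fin d) → ℝ) :
    Continuous (multilinearPoly c) := by
  unfold multilinearPoly
  fun_prop

theorem multilinearPoly_update {d : ℕ} (c : Finset (Fin d) → ℝ) (x : Fin d → ℝ) (k : Fin d)
    (θ a b : ℝ) : multilinearPoly c (Function.update x k ((1 - θ) * a + θ * b)) =
      (1 - θ) * multilinearPoly c (Function.update x k a) +
        θ * multilinearPoly c (Function.update x k b) := by
  simp only [multilinearPoly, Finset.mul_sum, ← Finset.sum_add_distrib]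
  refine Finset.sum_congr rfl fun T _ => ?_
  by_cases hk : k ∈ T
  · have h : ∀ s : ℝ, ∏ j ∈ T, Function.update x k s j = s * ∏ j ∈ T.erase k, x j := by
      intro s
      rw [← Finset.mul_prod_erase T _ hk, Function.update_self]
      congr 1
      exact Finset.prod_congr rfl fun j hj => Function.update_of_ne (Finset.ne_of_mem_erase hj) _ _
    rw [h, h, h]
    ring
  · have h : ∀ s : ℝ, ∏ j ∈ T, Function.update x k s j = ∏ j ∈ T, x j := fun s =>
      Finset.prod_congr rfl fun j hj => Function.update_of_ne (ne_of_mem_of_not_mem hj hk) _ _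
    rw [h, h, h]
    ring

/-- `x` lies in the closed grid cell with lower corner `j`. -/
def InCell {d : ℕ} (lvl j : Fin d → ℕ) (x : Fin d → ℝ) : Prop :=
  ∀ k, (j k : ℝ) * hmesh d lvl k ≤ x k ∧ x k ≤ ((j k : ℝ) + 1) * hmesh d lvl k

theorem exists_inCell {d : ℕ} (lvl : Fin d → ℕ) {x : Fin d → ℝ} (hx : x ∈ unitCube d) :
    ∃ j : Fin d → ℕ, (∀ k, j k < 2 ^ lvl k) ∧ InCell lvl j x := by
  have key : ∀ k, ∃ m : ℕ, m < 2 ^ lvl k ∧ (m : ℝ) * hmesh d lvl k ≤ x k ∧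
      x k ≤ ((m : ℝ) + 1) * hmesh d lvl k := by
    intro k
    obtain ⟨h0, h1⟩ := mem_unitCube.1 hx k
    have hn : (0 : ℝ) < 2 ^ lvl k := by positivity
    simp only [hmesh, ← div_eq_mul_inv, div_le_iff₀ hn, le_div_iff₀ hn]
    rcases h1.lt_or_eq with h | h
    · refine ⟨⌊x k * 2 ^ lvl k⌋₊, ?_, Nat.floor_le (by positivity), (Nat.lt_floor_add_one _).le⟩
      rw [Nat.floor_lt (by positivity)]
      push_cast
      nlinarith
    · have h2 : 1 ≤ 2 ^ lvl k := Nat.one_le_two_pow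
      refine ⟨2 ^ lvl k - 1, by omega, ?_⟩
      rw [Nat.cast_sub h2, h]
      push_cast
      constructor <;> linarith
  choose j hj hc using key
  exact ⟨j, hj, hc⟩

section Level

variable {d : ℕ} {lvl : Fin d → ℕ} {M : ℕ} (hM : 0 < M) {r : Fin d → ℕ}
  (hn : ∀ k, M = r k * 2 ^ lvl k) {U : (Fin d → ℕ) → ℝ} {g : (Fin d → ℝ) → ℝ}

include hM hn

theorem hmesh_eq (k : Fin d) : hmesh d lvl k = (r k : ℝ) / M := by
  have hM' : (0 : ℝ) < M := by exact_mod_cast hM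
  have h : (M : ℝ) = r k * 2 ^ lvl k := by exact_mod_cast hn k
  have hr : (r k : ℝ) ≠ 0 := fun e => by rw [e, zero_mul] at h; exact hM'.ne' h
  rw [hmesh, h]
  field_simp

theorem gridpt_toNat {j : Fin d → ℤ} (hj : ∀ k, 0 ≤ j k) :
    gridpt d lvl (fun k => (j k).toNat) = fun k => ((r k * j k : ℤ) : ℝ) / M := by
  ext k
  have : (((j k).toNat : ℕ) : ℝ) = ((j k : ℤ) : ℝ) := by
    exact_mod_cast Int.toNat_of_nonneg (hj k)
  rw [gridpt, hmesh_eq hM hn, this]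
  push_cast
  ring

theorem interpolant_node (hg : IsInterp d lvl U g) {j : Fin d → ℤ}
    (hj : ∀ k, 0 ≤ j k ∧ j k ≤ (2 ^ lvl k : ℕ)) :
    g (fun k => ((r k * j k : ℤ) : ℝ) / M) = U fun k => (j k).toNat := by
  rw [← gridpt_toNat hM hn fun k => (hj k).1]
  refine hg.1 _ fun k => ?_
  exact Int.toNat_le.2 (hj k).2

theorem interp_op_interpolant (hg : IsInterp d lvl U g) (k : Fin d) {i : Fin d → ℤ}
    (hi : ∀ k, 0 ≤ i k ∧ i k ≤ M) :
    (interp (r k)).op k (fun i => g fun k => (i k : ℝ) / M) i = g fun k => (i k : ℝ) / M := by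
  have hM' : (0 : ℝ) < M := by exact_mod_cast hM
  rw [Stencil.op_eq_apply]
  by_cases hdvd : (r k : ℤ) ∣ i k
  · rw [interp_apply_of_dvd _ hdvd, Function.update_eq_self]
  have hr0 : 0 < r k := Nat.pos_of_ne_zero fun e => hM.ne' (by rw [hn k, e, zero_mul])
  have hr0' : (0 : ℝ) < r k := by exact_mod_cast hr0
  set p : Fin d → ℝ := fun k => (i k : ℝ) / M with hp
  have hpc : p ∈ unitCube d := mem_unitCube.2 fun k => by
    have h0 : (0 : ℝ) ≤ i k := by exact_mod_cast (hi k).1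
    have h1 : (i k : ℝ) ≤ M := by exact_mod_cast (hi k).2
    exact ⟨by simp only [hp]; positivity, (div_le_one hM').2 h1⟩
  obtain ⟨j, hj, hcell⟩ := exists_inCell lvl hpc
  obtain ⟨c, hc⟩ := hg.2 j hj
  have hk := hcell k
  rw [hmesh_eq hM hn, hp, ← mul_div_assoc, ← mul_div_assoc, div_le_div_iff_of_pos_right hM',
    div_le_div_iff_of_pos_right hM'] at hk
  have hk0 : (j k : ℤ) * r k ≤ i k := by exact_mod_cast hk.1
  have hk1 : i k ≤ ((j k : ℤ) + 1) * r k := by exact_mod_cast hk.2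
  have hk2 : i k ≠ ((j k : ℤ) + 1) * r k := fun e => hdvd ⟨_, e.trans (mul_comm _ _)⟩
  have hmod : i k % r k = i k - j k * r k := by
    have : i k = (i k - j k * r k) + r k * j k := by ring
    rw [this, Int.add_mul_emod_self_left]
    rw [show i k - j k * r k + r k * j k - j k * r k = i k - j k * r k by ring]
    refine Int.emod_eq_of_lt (by linarith) ?_
    have := lt_of_le_of_ne hk1 hk2
    linarith
  have hline : ∀ t : ℤ, (j k : ℤ) * r k ≤ t → t ≤ ((j k : ℤ) + 1) * r k →
      g (fun m => ((Function.update i k t m : ℤ) : ℝ) / M) =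
        multilinearPoly c (Function.update p k ((t : ℝ) / M)) := by
    intro t h0 h1
    have e : (fun m => ((Function.update i k t m : ℤ) : ℝ) / M) =
        Function.update p k ((t : ℝ) / M) := by
      ext m
      by_cases h : m = k
      · subst h; simp
      · simp [Function.update_of_ne h, hp]
    rw [e]
    refine hc _ fun m => ?_
    by_cases h : m = k
    · subst h
      rw [Function.update_self, hmesh_eq hM hn, ← mul_div_assoc, ← mul_div_assoc,
        div_le_div_iff_of_pos_right hM', div_le_div_iff_of_pos_right hM']
      exact ⟨by exact_mod_cast h0, by exact_mod_cast h1⟩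
    · rw [Function.update_of_ne h]
      exact hcell m
  have hi0 := hline (i k) hk0 hk1
  rw [Function.update_eq_self] at hi0
  rw [interp_apply, hmod, hline _ (by linarith) (by linarith), hline _ (by linarith) (by linarith),
    hi0, ← multilinearPoly_update]
  congr 2
  push_cast
  field_simp
  ring

end Level

/-- Odd periodic extension of `u` to the grid with `M` cells in each direction. -/
noncomputable def oddSample {d : ℕ} (u : (Fin d → ℝ) → ℝ) (M : ℕ) : (Fin d → ℤ) → ℝ :=
  sample M Finset.univ (extDeriv u 0) 0

theorem gridOdd_oddSample {d : ℕ} {K : ℝ} {u : (Fin d → ℝ) → ℝ} (hu : MemXb d 4 K u) {M : ℕ}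
    (hM : 0 < M) : GridOdd M (oddSample u M) :=
  gridOdd_sample hM (fun _ _ => extDeriv_eq_zero hu fun _ => by simp) 0

theorem abs_diff4Prod_oddSample_le {d : ℕ} {K : ℝ} (hK : 0 ≤ K) {u : (Fin d → ℝ) → ℝ}
    (hu : MemXb d 4 K u) {M : ℕ} (hM : 2 ≤ M) (A : Finset (Fin d)) (i : Fin d → ℤ) :
    |diff4Prod M A (oddSample u M) i| ≤ K :=
  abs_diff4Prod_sample_le hM (derivFamily_extDeriv hK hu) A _ (Finset.subset_univ A) 0 0
    (by simp) (by simp) i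

theorem node_mem_unitCube {d M : ℕ} (hM : 0 < M) {i : Fin d → ℤ} (hi : ∀ k, 0 ≤ i k ∧ i k ≤ M) :
    (fun k => (i k : ℝ) / M) ∈ unitCube d := by
  have hM' : (0 : ℝ) < M := by exact_mod_cast hM
  refine mem_unitCube.2 fun k => ?_
  have h0 : (0 : ℝ) ≤ i k := by exact_mod_cast (hi k).1
  have h1 : (i k : ℝ) ≤ M := by exact_mod_cast (hi k).2
  exact ⟨by positivity, (div_le_one hM').2 h1⟩

theorem abs_sum_errTerm_sub_le {d : ℕ} (hd : 0 < d) {K : ℝ} (hK : 0 ≤ K)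
    {f u : (Fin d → ℝ) → ℝ} (hu : MemXb d 4 K u)
    (heq : ∀ x ∈ openCube d, ∑ i, pd d i (pd d i u) x = f x)
    {lvl : Fin d → ℕ} {U : (Fin d → ℕ) → ℝ} (hU : IsFDPoisson d lvl f U)
    {g : (Fin d → ℝ) → ℝ} (hg : IsInterp d lvl U g) {M : ℕ} (hM : 0 < M) {r : Fin d → ℕ}
    (hn : ∀ k, M = r k * 2 ^ lvl k) {i : Fin d → ℤ} (hi : ∀ k, 0 ≤ i k ∧ i k ≤ M) :
    |∑ J ∈ Finset.univ.filter (fun J : Finset (Fin d) => J.Nonempty),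
        errTerm M r (oddSample u M) J i -
      (u (fun k => (i k : ℝ) / M) - g fun k => (i k : ℝ) / M)| ≤ d * K / M / 8 := by
  have hM' : (0 : ℝ) < M := by exact_mod_cast hM
  have hr : ∀ k, r k ∣ M := fun k => ⟨_, hn k⟩
  have hr0 : ∀ k, (0 : ℤ) < r k := fun k => by exact_mod_cast Nat.pos_of_dvd_of_pos (hr k) hM
  have hnZ : ∀ k, (M : ℤ) = r k * (2 ^ lvl k : ℕ) := fun k => by exact_mod_cast hn k
  have hw := gridOdd_oddSample hu hM
  have hY : GridOdd M (∑ T, corr M r (oddSample u M) T) :=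
    (Submodule.sum_mem (latticeSpace M (fun _ : Fin d => 1)) fun T _ =>
      (corr_mem hw T).1.mem_latticeSpace_one).1
  have key := abs_interpProd_sub_le hM hr hd (n := fun k => 2 ^ lvl k) hn hY
    (G := fun i => g fun k => (i k : ℝ) / M) (U := fun j => U fun k => (j k).toNat)
    (ε := d * K / M) (by positivity) ?_ ?_ (fun j hj => interpolant_node hM hn hg hj)
    (fun k i hi => interp_op_interpolant hM hn hg k hi) i hi
  · have hs := congrFun (sum_errTerm (M := M) (r := r) hw) i
    rw [Finset.sum_apply] at hs
    have h0 : oddSample u M i = u fun k => (i k : ℝ) / M := by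
      rw [oddSample, sample_univ_of_mem hM _ _ hi, extDeriv,
        Set.indicator_of_mem (node_mem_unitCube hM hi), mderiv_zero]
    rw [hs, Pi.sub_apply, h0, ← abs_neg]
    refine le_of_eq_of_le ?_ key
    congr 1
    ring
  · rintro j hj ⟨k, hk⟩
    refine hU.1 _ (fun k => Int.toNat_le.2 (hj k).2) ⟨k, hk.imp (fun h => by simp [h]) fun h => ?_⟩
    rw [h, Int.toNat_natCast]
  · intro j hj
    set p : Fin d → ℝ := fun k => ((r k * j k : ℤ) : ℝ) / M with hp
    have hi' : ∀ k, 0 < (r k : ℤ) * j k ∧ (r k : ℤ) * j k < M := fun k => by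
      rw [hnZ k]
      exact ⟨mul_pos (hr0 k) (hj k).1, mul_lt_mul_of_pos_left (hj k).2 (hr0 k)⟩
    have hpo : p ∈ openCube d := fun k _ => by
      have h0 : (0 : ℝ) < ((r k * j k : ℤ) : ℝ) := by exact_mod_cast (hi' k).1
      have h1 : ((r k * j k : ℤ) : ℝ) < M := by exact_mod_cast (hi' k).2
      exact ⟨div_pos h0 hM', (div_lt_one hM').2 h1⟩
    have hpc : p ∈ unitCube d := node_mem_unitCube hM fun k => ⟨(hi' k).1.le, (hi' k).2.le⟩
    have hfd : ∑ k, ((2 ^ lvl k : ℕ) : ℝ) ^ 2 *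
        (U (fun m => (Function.update j k (j k + 1) m).toNat) - 2 * U (fun m => (j m).toNat) +
          U (fun m => (Function.update j k (j k - 1) m).toNat)) = ∑ k, pd d k (pd d k u) p := by
      rw [heq p hpo, hp, ← gridpt_toNat hM hn fun k => (hj k).1.le, ← hU.2]
      · refine Finset.sum_congr rfl fun k _ => ?_
        have e1 : (fun m => (Function.update j k (j k + 1) m).toNat) =
            Function.update (fun m => (j m).toNat) k ((j k).toNat + 1) := by
          ext m
          by_cases h : m = k
          · subst h
            have := (hj m).1
            simp only [Function.update_self]
            omega
          · simp [Function.update_of_ne h]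
        have e2 : (fun m => (Function.update j k (j k - 1) m).toNat) =
            Function.update (fun m => (j m).toNat) k ((j k).toNat - 1) := by
          ext m
          by_cases h : m = k
          · subst h
            have := (hj m).1
            simp only [Function.update_self]
            omega
          · simp [Function.update_of_ne h]
        rw [e1, e2, hmesh]
        push_cast
        field_simp
      · intro k
        have h1 := (hj k).1
        have h2 := (Int.toNat_lt h1.le).2 (hj k).2
        exact ⟨by omega, h2⟩
    rw [hfd, lap_sum_corr hM hr hw fun k => dvd_mul_right _ _, ← Finset.sum_sub_distrib]
    refine (Finset.abs_sum_le_sum_abs _ _).trans ?_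
    calc _ ≤ ∑ _k : Fin d, K / M := Finset.sum_le_sum fun k _ => by
          have := abs_diff2_sample_sub_le hM (derivFamily_extDeriv hK hu) 0 k hi'
          rwa [← oddSample, show extDeriv u (Function.update 0 k 2) _ = _ from
            Set.indicator_of_mem hpc _, mderiv_update_two] at this
      _ = d * K / M := by simp [mul_div_assoc]

/-! ### Passing to the limit -/

/-- Normalised error term on the auxiliary grid with `2 ^ N` cells in each direction. -/
noncomputable def approxCoeff {d : ℕ} (u : (Fin d → ℝ) → ℝ) (J : Finset (Fin d))
    (lvl : Fin d → ℕ) (x : Fin d → ℝ) (N : ℕ) : ℝ :=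
  errTerm (2 ^ N) (fun k => 2 ^ (N - lvl k)) (oddSample u (2 ^ N)) J
    (fun k => ⌊x k * 2 ^ N⌋) / ∏ j ∈ J, hmesh d lvl j ^ 2

/-- The coefficient function of the error expansion. -/
noncomputable def errCoeff {d : ℕ} (u : (Fin d → ℝ) → ℝ) (J : Finset (Fin d))
    (lvl : Fin d → ℕ) (x : Fin d → ℝ) : ℝ :=
  limUnder (hyperfilter ℕ : Filter ℕ) (approxCoeff u J lvl x)

theorem errCoeff_congr {d : ℕ} (u : (Fin d → ℝ) → ℝ) {J : Finset (Fin d)}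
    {lvl lvl' : Fin d → ℕ} (h : ∀ j ∈ J, lvl j = lvl' j) :
    errCoeff u J lvl = errCoeff u J lvl' := by
  ext x
  unfold errCoeff
  congr 1
  ext N
  rw [approxCoeff, approxCoeff, errTerm_congr (r' := fun k => 2 ^ (N - lvl' k)) _
    fun k hk => by rw [h k hk]]
  congr 1
  exact Finset.prod_congr rfl fun k hk => by rw [hmesh, hmesh, h k hk]

theorem two_pow_eq_mul {N l : ℕ} (h : l ≤ N) : 2 ^ N = 2 ^ (N - l) * 2 ^ l := by
  rw [← pow_add, Nat.sub_add_cancel h]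

theorem abs_approxCoeff_le {d : ℕ} {K : ℝ} (hK : 0 ≤ K) {u : (Fin d → ℝ) → ℝ}
    (hu : MemXb d 4 K u) (J : Finset (Fin d)) {lvl : Fin d → ℕ} (x : Fin d → ℝ) {N : ℕ}
    (hN : 1 ≤ N) (hl : ∀ k, lvl k ≤ N) :
    |approxCoeff u J lvl x N| ≤ 9 * K * (J.card.factorial / 96 ^ J.card) := by
  have hM : 2 ≤ 2 ^ N := by simpa using Nat.pow_le_pow_right (n := 2) (by norm_num) hN
  have hP : 0 < ∏ j ∈ J, hmesh d lvl j ^ 2 :=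
    Finset.prod_pos fun k _ => by rw [hmesh]; positivity
  rw [approxCoeff, abs_div, abs_of_pos hP, div_le_iff₀ hP]
  refine (abs_errTerm_le (by omega) (fun k => ⟨_, two_pow_eq_mul (hl k)⟩)
    (gridOdd_oddSample hu (by omega)) (abs_diff4Prod_oddSample_le hK hu hM) J _).trans_eq ?_
  congr 1
  refine Finset.prod_congr rfl fun k _ => ?_
  rw [hmesh_eq (M := 2 ^ N) (by omega) (r := fun k => 2 ^ (N - lvl k))
    fun k => two_pow_eq_mul (hl k)]

theorem eventually_level {d : ℕ} (lvl : Fin d → ℕ) :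
    ∀ᶠ N in (hyperfilter ℕ : Filter ℕ), 1 ≤ N ∧ ∀ k, lvl k ≤ N :=
  Nat.hyperfilter_le_atTop ((eventually_ge_atTop 1).and
    (eventually_all.2 fun k => eventually_ge_atTop (lvl k)))

theorem tendsto_approxCoeff {d : ℕ} {K : ℝ} (hK : 0 ≤ K) {u : (Fin d → ℝ) → ℝ}
    (hu : MemXb d 4 K u) (J : Finset (Fin d)) (lvl : Fin d → ℕ) (x : Fin d → ℝ) :
    |errCoeff u J lvl x| ≤ 9 * K * (J.card.factorial / 96 ^ J.card) ∧
      Tendsto (approxCoeff u J lvl x) (hyperfilter ℕ) (𝓝 (errCoeff u J lvl x)) := by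
  set B : ℝ := 9 * K * (J.card.factorial / 96 ^ J.card)
  obtain ⟨a, ha, hlim⟩ := (isCompact_Icc (a := -B) (b := B)).ultrafilter_le_nhds
    ((hyperfilter ℕ).map (approxCoeff u J lvl x)) (by
      rw [le_principal_iff, Ultrafilter.coe_map, mem_map]
      filter_upwards [eventually_level lvl] with N hN
      exact abs_le.1 (abs_approxCoeff_le hK hu J x hN.1 hN.2))
  have ht : Tendsto (approxCoeff u J lvl x) (hyperfilter ℕ) (𝓝 a) := hlim
  rw [errCoeff, ht.limUnder_eq]
  exact ⟨abs_le.2 ha, ht⟩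

theorem tendsto_floor_node {d : ℕ} (x : Fin d → ℝ) :
    Tendsto (fun N : ℕ => fun k => ((⌊x k * 2 ^ N⌋ : ℤ) : ℝ) / 2 ^ N) atTop (𝓝 x) := by
  refine tendsto_pi_nhds.2 fun k => ?_
  have h : Tendsto (fun N : ℕ => x k - (1 / 2 : ℝ) ^ N) atTop (𝓝 (x k)) := by
    simpa using tendsto_const_nhds.sub
      (tendsto_pow_atTop_nhds_zero_of_lt_one (by norm_num : (0 : ℝ) ≤ 1 / 2) (by norm_num))
  refine tendsto_of_tendsto_of_tendsto_of_le_of_le h tendsto_const_nhds (fun N => ?_) fun N => ?_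
  · simp only
    rw [le_div_iff₀ (by positivity), sub_mul, ← mul_pow]
    norm_num
    exact (Int.lt_floor_add_one _).le
  · simp only
    rw [div_le_iff₀ (by positivity)]
    exact Int.floor_le _

theorem floor_node_mem {d : ℕ} {x : Fin d → ℝ} (hx : x ∈ unitCube d) (N : ℕ) (k : Fin d) :
    0 ≤ ⌊x k * 2 ^ N⌋ ∧ ⌊x k * 2 ^ N⌋ ≤ (2 ^ N : ℕ) := by
  obtain ⟨h0, h1⟩ := mem_unitCube.1 hx k
  refine ⟨Int.floor_nonneg.2 (by positivity), ?_⟩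
  have : (⌊x k * 2 ^ N⌋ : ℝ) ≤ (2 ^ N : ℕ) := by
    refine (Int.floor_le _).trans ?_
    push_cast
    exact mul_le_of_le_one_left (by positivity) h1
  exact_mod_cast this

theorem inCell_floor_node {d : ℕ} {lvl j : Fin d → ℕ} {x : Fin d → ℝ} (hx : InCell lvl j x)
    {N : ℕ} (hl : ∀ k, lvl k ≤ N) : InCell lvl j fun k => ((⌊x k * 2 ^ N⌋ : ℤ) : ℝ) / 2 ^ N := by
  intro k
  have hN : (0 : ℝ) < 2 ^ N := by positivity
  have e : hmesh d lvl k = 2 ^ (N - lvl k) / 2 ^ N := by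
    simpa using hmesh_eq (M := 2 ^ N) (by positivity) (r := fun k => 2 ^ (N - lvl k))
      (fun k => two_pow_eq_mul (hl k)) k
  have hk := hx k
  rw [e, ← mul_div_assoc, ← mul_div_assoc, div_le_iff₀ hN, le_div_iff₀ hN] at hk
  simp only [e, ← mul_div_assoc, div_le_div_iff_of_pos_right hN]
  constructor
  · have h : ((j k * 2 ^ (N - lvl k) : ℕ) : ℤ) ≤ ⌊x k * 2 ^ N⌋ :=
      Int.le_floor.2 (by push_cast; exact hk.1)
    exact_mod_cast h
  · exact (Int.floor_le _).trans hk.2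

theorem sum_errCoeff {d : ℕ} (hd : 0 < d) {K : ℝ} (hK : 0 ≤ K)
    {f u : (Fin d → ℝ) → ℝ} (hu : MemXb d 4 K u)
    (heq : ∀ x ∈ openCube d, ∑ i, pd d i (pd d i u) x = f x)
    {lvl : Fin d → ℕ} {U : (Fin d → ℕ) → ℝ} (hU : IsFDPoisson d lvl f U)
    {g : (Fin d → ℝ) → ℝ} (hg : IsInterp d lvl U g) {x : Fin d → ℝ} (hx : x ∈ unitCube d) :
    u x - g x = ∑ J ∈ Finset.univ.filter (fun J : Finset (Fin d) => J.Nonempty),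
      errCoeff u J lvl x * ∏ j ∈ J, hmesh d lvl j ^ 2 := by
  set y : ℕ → Fin d → ℝ := fun N k => ((⌊x k * 2 ^ N⌋ : ℤ) : ℝ) / 2 ^ N with hy
  have hyx : Tendsto y (hyperfilter ℕ) (𝓝 x) :=
    (tendsto_floor_node x).mono_left Nat.hyperfilter_le_atTop
  have hymem : ∀ N, y N ∈ unitCube d := fun N => by
    simpa [hy] using node_mem_unitCube (M := 2 ^ N) (by positivity) (floor_node_mem hx N)
  have hulim : Tendsto (fun N => u (y N)) (hyperfilter ℕ) (𝓝 (u x)) := by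
    have hc := (hu.1.2 0 (by simp)).1 x hx
    rw [mderiv_zero] at hc
    exact hc.tendsto.comp (tendsto_nhdsWithin_iff.2 ⟨hyx, .of_forall hymem⟩)
  have hglim : Tendsto (fun N => g (y N)) (hyperfilter ℕ) (𝓝 (g x)) := by
    obtain ⟨j, hj, hcell⟩ := exists_inCell lvl hx
    obtain ⟨c, hc⟩ := hg.2 j hj
    rw [hc x hcell]
    refine (((continuous_multilinearPoly c).tendsto x).comp hyx).congr' ?_
    filter_upwards [eventually_level lvl] with N hN
    exact (hc _ (inCell_floor_node hcell hN.2)).symm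
  have hsum : Tendsto (fun N => ∑ J ∈ Finset.univ.filter (fun J : Finset (Fin d) => J.Nonempty),
      approxCoeff u J lvl x N * ∏ j ∈ J, hmesh d lvl j ^ 2) (hyperfilter ℕ)
      (𝓝 (∑ J ∈ Finset.univ.filter (fun J : Finset (Fin d) => J.Nonempty),
        errCoeff u J lvl x * ∏ j ∈ J, hmesh d lvl j ^ 2)) :=
    tendsto_finsetSum _ fun J _ => (tendsto_approxCoeff hK hu J lvl x).2.mul_const _
  have hε : Tendsto (fun N : ℕ => d * K / 8 * (1 / 2 : ℝ) ^ N) (hyperfilter ℕ) (𝓝 0) := by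
    have := (tendsto_pow_atTop_nhds_zero_of_lt_one (by norm_num : (0 : ℝ) ≤ 1 / 2)
      (by norm_num)).const_mul (d * K / 8)
    rw [mul_zero] at this
    exact this.mono_left Nat.hyperfilter_le_atTop
  have hdiff := squeeze_zero_norm' (f := fun N =>
    ∑ J ∈ Finset.univ.filter (fun J : Finset (Fin d) => J.Nonempty),
      approxCoeff u J lvl x N * ∏ j ∈ J, hmesh d lvl j ^ 2 - (u (y N) - g (y N))) ?_ hε
  · have := tendsto_nhds_unique hdiff (hsum.sub (hulim.sub hglim))
    linarith
  · filter_upwards [eventually_level lvl] with N hN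
    have hb := abs_sum_errTerm_sub_le hd hK hu heq hU hg (M := 2 ^ N) (by positivity)
      (r := fun k => 2 ^ (N - lvl k)) (fun k => two_pow_eq_mul (hN.2 k)) (floor_node_mem hx N)
    have he : ∀ J : Finset (Fin d), approxCoeff u J lvl x N * ∏ j ∈ J, hmesh d lvl j ^ 2 =
        errTerm (2 ^ N) (fun k => 2 ^ (N - lvl k)) (oddSample u (2 ^ N)) J
          (fun k => ⌊x k * 2 ^ N⌋) := fun J =>
      div_mul_cancel₀ _ (Finset.prod_pos fun k _ => by rw [hmesh]; positivity).ne'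
    simp only [he, Real.norm_eq_abs]
    push_cast at hb
    refine hb.trans_eq ?_
    rw [one_div, inv_pow]
    field_simp

end PoissonFD

/-- Full error expansion for the interpolated finite difference solution of the
Poisson problem (Theorem `error-expansion-total`):
`u - I u_h = Σ_{∅≠J} v_J(·;(h_j)_{j∈J}) Π_{j∈J} h_j²` with
`‖v_J‖_∞ ≤ 150188·K·m!/96^m`. -/
theorem poisson_total_error_expansion (d : ℕ) (hd : 1 ≤ d) (K : ℝ) (hK : 0 < K)
    (f u : (Fin d → ℝ) → ℝ) (hu : MemXb d 4 K u)
    (heq : ∀ x ∈ openCube d, ∑ i, pd d i (pd d i u) x = f x)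
    (hzero : ∀ x ∈ cubeBdry d, u x = 0) :
    ∃ v : Finset (Fin d) → (Fin d → ℕ) → (Fin d → ℝ) → ℝ,
      (∀ (J : Finset (Fin d)) (lvl lvl' : Fin d → ℕ),
        (∀ j ∈ J, lvl j = lvl' j) → v J lvl = v J lvl') ∧
      (∀ J : Finset (Fin d), J.Nonempty → ∀ lvl : Fin d → ℕ, ∀ x ∈ unitCube d,
        |v J lvl x| ≤ 150188 * K * (Nat.factorial J.card : ℝ) / (96 : ℝ) ^ J.card) ∧
      (∀ lvl : Fin d → ℕ, ∀ U : (Fin d → ℕ) → ℝ, IsFDPoisson d lvl f U →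
        ∀ g : (Fin d → ℝ) → ℝ, IsInterp d lvl U g →
          ∀ x ∈ unitCube d,
            u x - g x =
              ∑ J ∈ Finset.univ.filter (fun J : Finset (Fin d) => J.Nonempty),
                v J lvl x * ∏ j ∈ J, hmesh d lvl j ^ 2) := by
  refine ⟨PoissonFD.errCoeff u, fun J lvl lvl' h => PoissonFD.errCoeff_congr u h,
    fun J _ lvl x _ => ?_, fun lvl U hU g hg x hx =>
      PoissonFD.sum_errCoeff hd hK.le hu heq hU hg hx⟩
  refine (PoissonFD.tendsto_approxCoeff hK.le hu J lvl x).1.trans ?_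
  rw [mul_div_assoc]
  gcongr
  norm_num
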